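/- arXiv:1010.1285 — 13 statements merged into one kernel-verified Lean document; each statement's English description precedes it below -/
import Mathlib

section
/- Let Ω be a domain (nonempty connected open set) in ℂ, and let {f_j} be a sequence of holomorphic functions on Ω. Assume that the f_j converge pointwise on Ω to a limit function f. Then there exists a dense open subset V of Ω such that f is holomorphic on V and the convergence f_j → f is uniform on every compact subset of V. -/
open Filter Topology

/-- A pointwise convergent sequence of uniformly bounded holomorphic functions on a disc converges
locally uniformly on the concentric disc of half the radius. -/
theorem tendstoLocallyUniformlyOn_ball_of_norm_le {f : ℕ → ℂ → ℂ} {F : ℂ → ℂ} {c : ℂ} {r M : ℝ}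
    (hr : 0 < r) (hf : ∀ j, DifferentiableOn ℂ (f j) (Metric.ball c r))
    (hM : ∀ j, ∀ z ∈ Metric.ball c r, ‖f j z‖ ≤ M)
    (hconv : ∀ z ∈ Metric.ball c r, Tendsto (fun j => f j z) atTop (𝓝 (F z))) :
    TendstoLocallyUniformlyOn f F atTop (Metric.ball c (r / 2)) := by
  have hsub : Metric.ball c (r / 2) ⊆ Metric.ball c r := Metric.ball_subset_ball (by linarith)
  have hM0 : 0 ≤ M := (norm_nonneg _).trans (hM 0 c (Metric.mem_ball_self hr))
  obtain ⟨L, hL0, hL⟩ : ∃ L : ℝ, 0 < L ∧ ∀ j, ∀ x ∈ Metric.ball c (r / 2),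
      ∀ y ∈ Metric.ball c (r / 2), ‖f j y - f j x‖ ≤ L * ‖y - x‖ := by
    refine ⟨M / (r / 4) + 1, by positivity, fun j x hx y hy => ?_⟩
    refine (convex_ball c (r / 2)).norm_image_sub_le_of_norm_deriv_le (𝕜 := ℂ)
      (fun z hz => (hf j).differentiableAt (Metric.isOpen_ball.mem_nhds (hsub hz)))
      (fun z hz => ?_) hx hy
    have hz' : Metric.closedBall z (r / 4) ⊆ Metric.ball c r :=
      Metric.closedBall_subset_ball' (by rw [Metric.mem_ball] at hz; linarith)
    refine (Complex.norm_deriv_le_of_forall_mem_sphere_norm_le (by positivity) ?_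
      fun w hw => hM j w (hz' (Metric.sphere_subset_closedBall hw))).trans (by linarith)
    exact ((hf j).mono hz').diffContOnCl_ball subset_rfl
  have hLF : ∀ x ∈ Metric.ball c (r / 2), ∀ y ∈ Metric.ball c (r / 2),
      ‖F y - F x‖ ≤ L * ‖y - x‖ := fun x hx y hy =>
    le_of_tendsto ((hconv y (hsub hy)).sub (hconv x (hsub hx))).norm
      (Eventually.of_forall fun j => hL j x hx y hy)
  rw [Metric.tendstoLocallyUniformlyOn_iff]
  intro ε hε x hx
  refine ⟨Metric.ball c (r / 2) ∩ Metric.ball x (ε / (3 * L)),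
    inter_mem_nhdsWithin _ (Metric.ball_mem_nhds x (by positivity)), ?_⟩
  filter_upwards [Metric.tendsto_nhds.1 (hconv x (hsub hx)) (ε / 3) (by positivity)]
    with j hj y hy
  have hd : L * ‖y - x‖ < ε / 3 := by
    have := hy.2
    rw [Metric.mem_ball, dist_eq_norm, lt_div_iff₀ (by positivity)] at this
    linarith
  have h₁ := hLF x hx y hy.1
  have h₂ := hL j x hx y hy.1
  rw [dist_eq_norm] at hj ⊢
  calc ‖F y - f j y‖ = ‖(F y - F x) - (f j x - F x) - (f j y - f j x)‖ := by ring_nf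
    _ ≤ ‖F y - F x‖ + ‖f j x - F x‖ + ‖f j y - f j x‖ :=
      (norm_sub_le _ _).trans (by gcongr; exact norm_sub_le _ _)
    _ < ε := by linarith

/-- A pointwise bounded sequence of continuous functions on a disc is uniformly bounded on some
smaller disc. -/
theorem exists_ball_subset_forall_norm_le {f : ℕ → ℂ → ℂ} {c : ℂ} {r : ℝ} (hr : 0 < r)
    (hf : ∀ j, ContinuousOn (f j) (Metric.closedBall c r))
    (hbdd : ∀ z ∈ Metric.closedBall c r, ∃ M : ℝ, ∀ j, ‖f j z‖ ≤ M) :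
    ∃ x s M, 0 < s ∧ Metric.ball x s ⊆ Metric.ball c r ∧
      ∀ j, ∀ z ∈ Metric.ball x s, ‖f j z‖ ≤ M := by
  let A : ℕ → Set ℂ := fun n => ⋂ j, {z ∈ Metric.closedBall c r | ‖f j z‖ ≤ n}
  have hA : ∀ n, IsClosed (A n) := fun n => isClosed_iInter fun j =>
    Metric.isClosed_closedBall.isClosed_le (hf j).norm continuousOn_const
  have hdense := dense_iUnion_interior_of_closed
    (f := fun n => A n ∪ (Metric.ball c r)ᶜ)
    (fun n => (hA n).union Metric.isOpen_ball.isClosed_compl) (by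
      refine Set.eq_univ_of_forall fun z => Set.mem_iUnion.2 ?_
      by_cases hz : z ∈ Metric.ball c r
      · have hz' := Metric.ball_subset_closedBall hz
        obtain ⟨M, hM⟩ := hbdd z hz'
        obtain ⟨n, hn⟩ := exists_nat_ge M
        exact ⟨n, Or.inl (Set.mem_iInter.2 fun j => ⟨hz', (hM j).trans hn⟩)⟩
      · exact ⟨0, Or.inr hz⟩)
  obtain ⟨x, hx, hxi⟩ := hdense.inter_open_nonempty _ Metric.isOpen_ball
    (Metric.nonempty_ball.2 hr : (Metric.ball c r).Nonempty)
  obtain ⟨n, hn⟩ := Set.mem_iUnion.1 hxi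
  obtain ⟨s, hs, hsub⟩ := Metric.isOpen_iff.1 (Metric.isOpen_ball.inter isOpen_interior) x ⟨hx, hn⟩
  refine ⟨x, s, n, hs, fun z hz => (hsub hz).1, fun j z hz => ?_⟩
  obtain ⟨hzb, hzi⟩ := hsub hz
  rcases interior_subset hzi with h | h
  · exact (Set.mem_iInter.1 h j).2
  · exact absurd hzb h

/-- **Osgood's theorem.** If a sequence of holomorphic functions on a planar domain
converges pointwise, then the limit is holomorphic on a dense open subset, and the
convergence is uniform on compact subsets of that set. -/
theorem osgood_pointwise_limit_holomorphic
    (Ω : Set ℂ) (hΩopen : IsOpen Ω) (hΩconn : IsConnected Ω)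
    (f : ℕ → ℂ → ℂ) (F : ℂ → ℂ)
    (hf : ∀ j, DifferentiableOn ℂ (f j) Ω)
    (hconv : ∀ z ∈ Ω, Tendsto (fun j => f j z) atTop (𝓝 (F z))) :
    ∃ V : Set ℂ, IsOpen V ∧ V ⊆ Ω ∧ Ω ⊆ closure V ∧
      DifferentiableOn ℂ F V ∧
      ∀ K ⊆ V, IsCompact K → TendstoUniformlyOn f F atTop K := by
  let S : Set (Set ℂ) := {U | IsOpen U ∧ U ⊆ Ω ∧ TendstoLocallyUniformlyOn f F atTop U}
  have hVopen : IsOpen (⋃₀ S) := isOpen_sUnion fun U hU => hU.1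
  have hVsub : ⋃₀ S ⊆ Ω := Set.sUnion_subset fun U hU => hU.2.1
  have hVconv : TendstoLocallyUniformlyOn f F atTop (⋃₀ S) :=
    tendstoLocallyUniformlyOn_sUnion S (fun U hU => hU.1) fun U hU => hU.2.2
  refine ⟨⋃₀ S, hVopen, hVsub, fun z hz => ?_,
    hVconv.differentiableOn (Eventually.of_forall fun j => (hf j).mono hVsub) hVopen,
    (tendstoLocallyUniformlyOn_iff_forall_isCompact hVopen).1 hVconv⟩
  refine mem_closure_iff.2 fun W hW hzW => ?_
  obtain ⟨r, hr, hrsub⟩ := Metric.nhds_basis_closedBall.mem_iff.1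
    ((hW.inter hΩopen).mem_nhds ⟨hzW, hz⟩)
  obtain ⟨x, s, M, hs, hsub, hM⟩ := exists_ball_subset_forall_norm_le hr
    (fun j => (hf j).continuousOn.mono fun w hw => (hrsub hw).2) (fun w hw => by
      obtain ⟨M, hM⟩ := (hconv w (hrsub hw).2).norm.bddAbove_range
      exact ⟨M, fun j => hM ⟨j, rfl⟩⟩)
  have hsub' : Metric.ball x s ⊆ W ∩ Ω := (hsub.trans Metric.ball_subset_closedBall).trans hrsub
  have hmem : Metric.ball x (s / 2) ∈ S :=
    ⟨Metric.isOpen_ball, fun w hw => (hsub' (Metric.ball_subset_ball (by linarith) hw)).2,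
      tendstoLocallyUniformlyOn_ball_of_norm_le hs
        (fun j => (hf j).mono fun w hw => (hsub' hw).2) hM
        fun w hw => hconv w (hsub' hw).2⟩
  exact ⟨x, (hsub' (Metric.mem_ball_self hs)).1, _, hmem,
    Metric.mem_ball_self (half_pos hs)⟩
end

section
/- Let Ω be a domain (nonempty connected open set) in ℂ, and let {f_j} be a sequence of harmonic (real- or complex-valued) functions on Ω. Assume that the f_j converge pointwise on Ω to a limit function f. Then there exists a dense open subset V of Ω such that f is harmonic on V. -/
open Filter Topology

/-- The Laplacian of a function `u : ℂ → ℂ`, viewing `ℂ ≅ ℝ²`: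
`Δu = ∂²u/∂x² + ∂²u/∂y²`, computed as the sum of the second directional
derivatives in the directions `1` and `I`. -/
noncomputable def laplacian (u : ℂ → ℂ) (z : ℂ) : ℂ :=
  fderiv ℝ (fun w => fderiv ℝ u w 1) z 1 +
    fderiv ℝ (fun w => fderiv ℝ u w Complex.I) z Complex.I

/-- A function is harmonic on an open set `U ⊆ ℂ` if it is twice continuously
(real-)differentiable there and its Laplacian vanishes identically on `U`. -/
def HarmonicOnSet (u : ℂ → ℂ) (U : Set ℂ) : Prop :=
  ContDiffOn ℝ 2 u U ∧ ∀ z ∈ U, laplacian u z = 0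

open InnerProductSpace Metric Real in
/-- The Poisson integral of a circle-integrable function is harmonic. -/
lemma harmonicOnNhd_circleAverage_re_herglotzRieszKernel_smul {g : ℂ → ℝ} {c : ℂ} {R : ℝ}
    (hg : CircleIntegrable g c R) :
    HarmonicOnNhd (fun w => circleAverage ((Complex.re ∘ herglotzRieszKernel c w) • g) c R)
      (ball c R) := by
  have hg₀ : CircleIntegrable (fun z => g (z + c)) 0 R := by
    simpa [CircleIntegrable, circleMap, add_comm] using hg
  have hgc : CircleIntegrable (fun z => (g (z + c) : ℂ)) 0 R := by
    simp only [CircleIntegrable, intervalIntegrable_iff] at hg₀ ⊢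
    exact Complex.ofRealCLM.integrable_comp hg₀
  intro w hw
  have hw₀ : w - c ∈ ball (0 : ℂ) R := by simpa [dist_eq_norm] using hw
  have han := (analyticOnNhd_circleAverage_herglotzRieszKernel_smul hgc (w - c) hw₀).fun_comp_of_eq
    (f := fun w => w - c) (x := w) (by fun_prop) rfl
  refine (harmonicAt_congr_nhds ?_).1 han.harmonicAt_re
  filter_upwards [isOpen_ball.mem_nhds hw] with v hv
  have hv₀ : v - c ∈ ball (0 : ℂ) R := by simpa [dist_eq_norm] using hv
  rw [re_circleAverage_herglotzRieszKernel_smul hg₀ hv₀,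
    ← circleAverage_map_add_const (c := c)]
  simp [herglotzRieszKernel_def, Pi.mul_def]

open InnerProductSpace Metric Real MeasureTheory in
/-- A bounded pointwise limit of real harmonic functions is harmonic. -/
lemma harmonicOnNhd_of_tendsto_of_bounded {f : ℕ → ℂ → ℝ} {F : ℂ → ℝ} {c : ℂ} {R M : ℝ}
    (hf : ∀ j, HarmonicOnNhd (f j) (closedBall c R))
    (hM : ∀ j, ∀ z ∈ closedBall c R, |f j z| ≤ M)
    (hlim : ∀ z ∈ closedBall c R, Tendsto (fun j => f j z) atTop (𝓝 (F z))) :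
    HarmonicOnNhd F (ball c R) := by
  intro w hw
  have hR : 0 < R := pos_of_mem_ball hw
  have hmem (θ : ℝ) : circleMap c R θ ∈ closedBall c R := circleMap_mem_closedBall c hR.le θ
  have hcont (j : ℕ) : Continuous fun θ => f j (circleMap c R θ) :=
    (hf j).continuousOn.comp_continuous (continuous_circleMap c R) hmem
  have hmeas : Measurable fun θ => F (circleMap c R θ) :=
    measurable_of_tendsto_metrizable (fun j => (hcont j).measurable)
      (tendsto_pi_nhds.2 fun θ => hlim _ (hmem θ))
  have hint : CircleIntegrable F c R := by
    refine (intervalIntegrable_const (c := M)).mono_fun hmeas.aestronglyMeasurable ?_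
    filter_upwards with θ
    exact (le_of_tendsto' (hlim _ (hmem θ)).abs fun j => hM j _ (hmem θ)).trans (le_abs_self M)
  refine (harmonicAt_congr_nhds ?_).1
    (harmonicOnNhd_circleAverage_re_herglotzRieszKernel_smul hint w hw)
  filter_upwards [isOpen_ball.mem_nhds hw] with v hv
  have hker : Continuous fun θ => (herglotzRieszKernel c v (circleMap c R θ)).re :=
    Complex.continuous_re.comp ((continuousOn_herglotzRieszKernel_sphere hv).comp_continuous
      (continuous_circleMap c R) (circleMap_mem_sphere' c R))
  have htend : Tendsto
      (fun j => circleAverage ((Complex.re ∘ herglotzRieszKernel c v) • f j) c R) atTop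
      (𝓝 (circleAverage ((Complex.re ∘ herglotzRieszKernel c v) • F) c R)) := by
    refine Tendsto.const_smul (intervalIntegral.tendsto_integral_filter_of_dominated_convergence
      (fun θ => |(herglotzRieszKernel c v (circleMap c R θ)).re| * M) ?_ ?_ ?_ ?_) _
    · exact .of_forall fun j => (hker.mul (hcont j)).aestronglyMeasurable
    · refine .of_forall fun j => .of_forall fun θ _ => ?_
      simp only [Pi.smul_apply', Function.comp_apply, smul_eq_mul, norm_mul, Real.norm_eq_abs]
      gcongr
      exact hM j _ (hmem θ)
    · exact (hker.abs.mul continuous_const).intervalIntegrable _ _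
    · exact .of_forall fun θ _ => (hlim _ (hmem θ)).const_mul _
  refine tendsto_nhds_unique htend ((hlim v (ball_subset_closedBall hv)).congr fun j => ?_)
  exact ((hf j).circleAverage_re_herglotzRieszKernel_smul hv).symm

lemma laplacian_eq_of_contDiffAt {u : ℂ → ℂ} {z : ℂ} (hu : ContDiffAt ℝ 2 u z) :
    laplacian u z = Laplacian.laplacian u z := by
  have hd : DifferentiableAt ℝ (fderiv ℝ u) z :=
    (hu.fderiv_right (m := 1) (by norm_num)).differentiableAt one_ne_zero
  have hdir (v : ℂ) : fderiv ℝ (fun w => fderiv ℝ u w v) z = (fderiv ℝ (fderiv ℝ u) z).flip v := by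
    simp [fderiv_clm_apply hd (differentiableAt_const v)]
  simp [laplacian, hdir, InnerProductSpace.laplacian_eq_iteratedFDeriv_complexPlane,
    iteratedFDeriv_two_apply]

open InnerProductSpace in
lemma harmonicOnSet_iff_harmonicOnNhd {u : ℂ → ℂ} {U : Set ℂ} (hU : IsOpen U) :
    HarmonicOnSet u U ↔ HarmonicOnNhd u U := by
  refine ⟨fun h z hz => ⟨h.1.contDiffAt (hU.mem_nhds hz), ?_⟩, fun h => ⟨h.contDiffOn, ?_⟩⟩
  · filter_upwards [hU.mem_nhds hz] with w hw
    rw [← laplacian_eq_of_contDiffAt (h.1.contDiffAt (hU.mem_nhds hw)), h.2 w hw, Pi.zero_apply]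
  · intro z hz
    rw [laplacian_eq_of_contDiffAt (h z hz).1, (h z hz).2.eq_of_nhds, Pi.zero_apply]

open InnerProductSpace in
lemma harmonicAt_of_re_im {u : ℂ → ℂ} {z : ℂ} (hre : HarmonicAt (fun w => (u w).re) z)
    (him : HarmonicAt (fun w => (u w).im) z) : HarmonicAt u z := by
  have h := (hre.comp_CLM Complex.ofRealCLM).add
    (him.comp_CLM ((ContinuousLinearMap.mul ℝ ℂ Complex.I).comp Complex.ofRealCLM))
  convert h using 1
  ext w
  simp [mul_comm Complex.I, Complex.re_add_im]

open Metric in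
/-- A sequence of continuous functions that is pointwise bounded on a closed ball is
uniformly bounded on some smaller closed ball. -/
lemma exists_closedBall_forall_norm_le {f : ℕ → ℂ → ℂ} {c : ℂ} {r : ℝ} (hr : 0 < r)
    (hf : ∀ j, ContinuousOn (f j) (closedBall c r))
    (hb : ∀ z ∈ closedBall c r, ∃ M : ℝ, ∀ j, ‖f j z‖ ≤ M) :
    ∃ (M : ℝ) (w : ℂ) (ρ : ℝ), 0 < ρ ∧ closedBall w ρ ⊆ ball c r ∧
      ∀ j, ∀ z ∈ closedBall w ρ, ‖f j z‖ ≤ M := by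
  let E (n : ℕ) : Set ℂ := (ball c r)ᶜ ∪ ⋂ j, closedBall c r ∩ f j ⁻¹' closedBall 0 n
  have hclosed (n : ℕ) : IsClosed (E n) :=
    isOpen_ball.isClosed_compl.union (isClosed_iInter fun j =>
      (hf j).preimage_isClosed_of_isClosed isClosed_closedBall isClosed_closedBall)
  have hcover : ⋃ n, E n = Set.univ := by
    refine Set.eq_univ_of_forall fun z => Set.mem_iUnion.2 ?_
    by_cases hz : z ∈ ball c r
    · obtain ⟨M, hM⟩ := hb z (ball_subset_closedBall hz)
      obtain ⟨n, hn⟩ := exists_nat_ge M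
      exact ⟨n, .inr <| Set.mem_iInter.2 fun j => ⟨ball_subset_closedBall hz,
        mem_closedBall_zero_iff.2 ((hM j).trans hn)⟩⟩
    · exact ⟨0, .inl hz⟩
  obtain ⟨w, hw, hwE⟩ := (dense_iUnion_interior_of_closed hclosed hcover).inter_open_nonempty
    _ isOpen_ball ⟨c, mem_ball_self hr⟩
  obtain ⟨n, hn⟩ := Set.mem_iUnion.1 hwE
  obtain ⟨ρ, hρ, hsub⟩ := nhds_basis_closedBall.mem_iff.1
    ((isOpen_ball.inter isOpen_interior).mem_nhds ⟨hw, hn⟩)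
  refine ⟨n, w, ρ, hρ, hsub.trans Set.inter_subset_left, fun j z hz => ?_⟩
  have hzE := (interior_subset (hsub hz).2).resolve_left fun h => h (hsub hz).1
  exact mem_closedBall_zero_iff.1 (Set.mem_iInter.1 hzE j).2

/-- If a sequence of harmonic functions on a planar domain converges pointwise,
then the limit function is harmonic on a dense open subset of the domain. -/
theorem pointwise_limit_of_harmonic_is_harmonic_on_dense_open
    (Ω : Set ℂ) (hΩopen : IsOpen Ω) (hΩconn : IsConnected Ω)
    (f : ℕ → ℂ → ℂ) (F : ℂ → ℂ)
    (hf : ∀ j, HarmonicOnSet (f j) Ω)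
    (hconv : ∀ z ∈ Ω, Tendsto (fun j => f j z) atTop (𝓝 (F z))) :
    ∃ V : Set ℂ, IsOpen V ∧ V ⊆ Ω ∧ Ω ⊆ closure V ∧ HarmonicOnSet F V := by
  have hfN (j : ℕ) := (harmonicOnSet_iff_harmonicOnNhd hΩopen).1 (hf j)
  have hopen := hΩopen.inter (InnerProductSpace.isOpen_setOfPred_harmonicAt F)
  refine ⟨_, hopen, Set.inter_subset_left, fun z hz => ?_,
    (harmonicOnSet_iff_harmonicOnNhd hopen).2 fun w hw => hw.2⟩
  refine Metric.mem_closure_iff.2 fun ε hε => ?_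
  obtain ⟨r, hr, hsub⟩ := Metric.nhds_basis_closedBall.mem_iff.1
    (inter_mem (hΩopen.mem_nhds hz) (Metric.ball_mem_nhds z hε))
  have hrΩ := hsub.trans Set.inter_subset_left
  obtain ⟨M, w, ρ, hρ, hwsub, hM⟩ := exists_closedBall_forall_norm_le hr
    (fun j => (hf j).1.continuousOn.mono hrΩ) (fun y hy => by
      obtain ⟨M, hM⟩ := (hconv y (hrΩ hy)).norm.bddAbove_range
      exact ⟨M, fun j => hM ⟨j, rfl⟩⟩)
  have hwr := hwsub.trans Metric.ball_subset_closedBall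
  have hwΩ := hwr.trans hrΩ
  have hw := hsub (hwr (Metric.mem_closedBall_self hρ.le))
  refine ⟨w, ⟨hw.1, harmonicAt_of_re_im ?_ ?_⟩, Metric.mem_ball'.1 hw.2⟩
  · exact harmonicOnNhd_of_tendsto_of_bounded
      (fun j => ((hfN j).mono hwΩ).comp_CLM Complex.reCLM)
      (fun j y hy => (Complex.abs_re_le_norm _).trans (hM j y hy))
      (fun y hy => (Complex.continuous_re.tendsto _).comp (hconv y (hwΩ hy)))
      w (Metric.mem_ball_self hρ)
  · exact harmonicOnNhd_of_tendsto_of_bounded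
      (fun j => ((hfN j).mono hwΩ).comp_CLM Complex.imCLM)
      (fun j y hy => (Complex.abs_im_le_norm _).trans (hM j y hy))
      (fun y hy => (Complex.continuous_im.tendsto _).comp (hconv y (hwΩ hy)))
      w (Metric.mem_ball_self hρ)
end

section
/- Let Ω be a domain (nonempty connected open set) in ℂ, and let {f_j} be a sequence of holomorphic functions on Ω. Suppose there is a constant M > 0 such that |f_j(z)| ≤ M for all j and all z ∈ Ω. Assume that the f_j converge pointwise on Ω to a limit function f. Then f is holomorphic on all of Ω. -/
open Filter Topology

/-- A bounded pointwise limit of continuous functions on a circle is circle integrable. -/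
theorem circleIntegrable_of_tendsto_of_norm_le {f : ℕ → ℂ → ℂ} {F : ℂ → ℂ} {c : ℂ} {R M : ℝ}
    (hR : 0 ≤ R) (hf : ∀ j, ContinuousOn (f j) (Metric.sphere c R))
    (hbd : ∀ j, ∀ z ∈ Metric.sphere c R, ‖f j z‖ ≤ M)
    (hconv : ∀ z ∈ Metric.sphere c R, Tendsto (fun j => f j z) atTop (𝓝 (F z))) :
    CircleIntegrable F c R := by
  have hmem := circleMap_mem_sphere c hR
  refine (intervalIntegrable_const (c := M)).mono_fun (μ := MeasureTheory.volume) ?_ ?_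
  · exact aestronglyMeasurable_of_tendsto_ae atTop
      (fun j => ((hf j).comp_continuous (continuous_circleMap c R) hmem).aestronglyMeasurable)
      (Eventually.of_forall fun θ => hconv _ (hmem θ))
  · refine Eventually.of_forall fun θ => le_trans ?_ (le_abs_self M)
    exact le_of_tendsto (hconv _ (hmem θ)).norm (Eventually.of_forall fun j => hbd j _ (hmem θ))

/-- Bounded convergence for circle integrals against a continuous kernel. -/
theorem tendsto_circleIntegral_smul_of_norm_le {f : ℕ → ℂ → ℂ} {F k : ℂ → ℂ} {c : ℂ} {R M : ℝ}
    (hR : 0 ≤ R) (hk : ContinuousOn k (Metric.sphere c R))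
    (hf : ∀ j, ContinuousOn (f j) (Metric.sphere c R))
    (hbd : ∀ j, ∀ z ∈ Metric.sphere c R, ‖f j z‖ ≤ M)
    (hconv : ∀ z ∈ Metric.sphere c R, Tendsto (fun j => f j z) atTop (𝓝 (F z))) :
    Tendsto (fun j => ∮ z in C(c, R), k z • f j z) atTop (𝓝 (∮ z in C(c, R), k z • F z)) := by
  have hmem := circleMap_mem_sphere c hR
  have hkc := hk.comp_continuous (continuous_circleMap c R) hmem
  have hdc : Continuous (deriv (circleMap c R)) := by
    simp only [funext (deriv_circleMap c R)]
    fun_prop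
  refine intervalIntegral.tendsto_integral_filter_of_dominated_convergence
    (fun θ => ‖deriv (circleMap c R) θ‖ * (‖k (circleMap c R θ)‖ * M)) ?_ ?_ ?_ ?_
  · exact Eventually.of_forall fun j => (hdc.smul (hkc.smul
      ((hf j).comp_continuous (continuous_circleMap c R) hmem))).aestronglyMeasurable
  · refine Eventually.of_forall fun j => Eventually.of_forall fun θ _ => ?_
    rw [norm_smul, norm_smul]
    gcongr
    exact hbd j _ (hmem θ)
  · exact (hdc.norm.mul (hkc.norm.mul continuous_const)).intervalIntegrable _ _
  · exact Eventually.of_forall fun θ _ =>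
      ((hconv _ (hmem θ)).const_smul _).const_smul _

/-- **Stieltjes.** A uniformly bounded sequence of holomorphic functions on a planar
domain that converges pointwise has a holomorphic limit on the whole domain. -/
theorem pointwise_limit_of_uniformly_bounded_holomorphic
    (Ω : Set ℂ) (hΩopen : IsOpen Ω) (hΩconn : IsConnected Ω)
    (f : ℕ → ℂ → ℂ) (F : ℂ → ℂ) (M : ℝ) (hM : 0 < M)
    (hf : ∀ j, DifferentiableOn ℂ (f j) Ω)
    (hbd : ∀ j, ∀ z ∈ Ω, ‖f j z‖ ≤ M)
    (hconv : ∀ z ∈ Ω, Tendsto (fun j => f j z) atTop (𝓝 (F z))) :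
    DifferentiableOn ℂ F Ω := by
  intro c hc
  obtain ⟨r, hr, hball⟩ := Metric.nhds_basis_closedBall.mem_iff.mp (hΩopen.mem_nhds hc)
  lift r to NNReal using hr.le
  have hsphere : Metric.sphere c (r : ℝ) ⊆ Ω := Metric.sphere_subset_closedBall.trans hball
  have hcont j : ContinuousOn (f j) (Metric.sphere c r) := (hf j).continuousOn.mono hsphere
  have hbd' j z (hz : z ∈ Metric.sphere c (r : ℝ)) := hbd j z (hsphere hz)
  have hconv' z (hz : z ∈ Metric.sphere c (r : ℝ)) := hconv z (hsphere hz)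
  have hpow := hasFPowerSeriesOn_cauchy_integral
    (circleIntegrable_of_tendsto_of_norm_le r.2 hcont hbd' hconv') (NNReal.coe_pos.mp hr)
  refine (hpow.analyticAt.differentiableAt.congr_of_eventuallyEq ?_).differentiableWithinAt
  filter_upwards [Metric.ball_mem_nhds c hr] with w hw
  have hk : ContinuousOn (fun z => (z - w)⁻¹) (Metric.sphere c (r : ℝ)) := by
    refine (continuousOn_id.sub continuousOn_const).inv₀ fun z hz => sub_ne_zero.mpr ?_
    rintro rfl
    exact (Metric.mem_ball.mp hw).ne (Metric.mem_sphere.mp hz)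
  refine tendsto_nhds_unique (hconv w (hball (Metric.ball_subset_closedBall hw))) ?_
  refine ((tendsto_circleIntegral_smul_of_norm_le r.2 hk hcont hbd' hconv').const_smul
    (2 * Real.pi * Complex.I : ℂ)⁻¹).congr fun j => ?_
  exact ((hf j).mono hball).diffContOnCl_ball subset_rfl
    |>.two_pi_i_inv_smul_circleIntegral_sub_inv_smul hw
end

section
/- Let Ω be a domain (nonempty connected open set) in ℂ, and let {f_j} be a sequence of holomorphic functions on Ω. Suppose there is a nonnegative Lebesgue-integrable function g on Ω such that |f_j(z)| ≤ g(z) for all j and all z ∈ Ω. Assume that the f_j converge pointwise on Ω to a limit function f. Then f is holomorphic on all of Ω. -/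
open Filter Topology MeasureTheory

open Metric Real in
/-- The area **mean value property** of complex differentiable functions. -/
theorem setIntegral_closedBall_of_diffContOnCl {E : Type*} [NormedAddCommGroup E] [NormedSpace ℂ E]
    [CompleteSpace E] {f : ℂ → E} {c : ℂ} {r : ℝ} (hr : 0 < r)
    (hf : DiffContOnCl ℂ f (ball c r)) :
    ∫ z in closedBall c r, f z = volume.real (closedBall c r) • f c := by
  have hcont : ContinuousOn f (closedBall c r) := by
    simpa [closure_ball _ hr.ne'] using hf.continuousOn
  have hmaps : ∀ t w : ℂ, ‖t‖ ≤ 1 → ‖w‖ ≤ r → c + t * w ∈ closedBall c r := by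
    intro t w ht hw
    simpa using (mul_le_mul ht hw (norm_nonneg w) zero_le_one).trans_eq (one_mul r)
  have hcirc : ∀ w ∈ closedBall (0 : ℂ) r,
      ∫ θ in (0)..(2 * π), f (c + circleMap 0 1 θ * w) = (2 * π) • f c := by
    intro w hw
    rw [mem_closedBall_zero_iff] at hw
    have h : circleAverage (fun t ↦ f (c + t * w)) 0 1 = f (c + 0 * w) := by
      refine circleAverage_of_differentiable_on_off_countable Set.countable_empty ?_ ?_
      · refine hcont.comp (by fun_prop) fun t ht ↦ hmaps t w (by simpa using ht) hw
      · intro t ht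
        have ht' : ‖t‖ < 1 := by simpa using ht.1
        have hmem : c + t * w ∈ ball c r := by
          simpa using (mul_le_mul_of_nonneg_left hw (norm_nonneg t)).trans_lt
            (mul_lt_of_lt_one_left hr ht')
        exact DifferentiableAt.comp t
          (hf.differentiableOn.differentiableAt (isOpen_ball.mem_nhds hmem)) (by fun_prop)
    rw [circleAverage_def, inv_smul_eq_iff₀ (by positivity)] at h
    simpa using h
  have htrans : ∫ z in closedBall c r, f z = ∫ w in closedBall (0 : ℂ) r, f (c + w) := by
    rw [← (measurePreserving_add_left volume c).setIntegral_preimage_emb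
      (measurableEmbedding_addLeft c)]
    simp
  have hrot : ∀ θ : ℝ, ∫ w in closedBall (0 : ℂ) r, f (c + circleMap 0 1 θ * w)
      = ∫ w in closedBall (0 : ℂ) r, f (c + w) := by
    intro θ
    have h := (rotation (Circle.exp θ)).measurePreserving.setIntegral_preimage_emb
      (rotation (Circle.exp θ)).toHomeomorph.measurableEmbedding (fun w ↦ f (c + w))
      (closedBall (0 : ℂ) r)
    simpa [circleMap_zero, LinearIsometryEquiv.map_zero] using h
  have hint : Integrable (Function.uncurry fun (θ : ℝ) (w : ℂ) ↦ f (c + circleMap 0 1 θ * w))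
      ((volume.restrict (Set.Ioc 0 (2 * π))).prod (volume.restrict (closedBall (0 : ℂ) r))) := by
    rw [Measure.prod_restrict]
    have : ContinuousOn (Function.uncurry fun (θ : ℝ) (w : ℂ) ↦ f (c + circleMap 0 1 θ * w))
        (Set.Icc 0 (2 * π) ×ˢ closedBall (0 : ℂ) r) := by
      refine hcont.comp (f := fun p : ℝ × ℂ ↦ c + circleMap 0 1 p.1 * p.2)
        (by fun_prop) fun p hp ↦ hmaps _ _ (by simp) (by simpa using hp.2)
    exact (this.integrableOn_compact (isCompact_Icc.prod (isCompact_closedBall _ _))).mono_set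
      (Set.prod_mono Set.Ioc_subset_Icc_self subset_rfl)
  have hswap := integral_integral_swap hint
  simp_rw [hrot, ← intervalIntegral.integral_of_le two_pi_pos.le] at hswap
  rw [setIntegral_congr_fun measurableSet_closedBall hcirc] at hswap
  have hvol : volume.real (closedBall (0 : ℂ) r) = volume.real (closedBall c r) := by
    simp [Measure.real]
  rw [htrans]
  simp only [integral_const, intervalIntegral.integral_const, sub_zero, measureReal_restrict_apply,
    MeasurableSet.univ, Set.univ_inter, hvol] at hswap
  rw [smul_comm] at hswap
  exact smul_right_injective E two_pi_pos.ne' hswap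

/-- If a sequence of holomorphic functions on a planar domain is dominated by a fixed
nonnegative Lebesgue-integrable function and converges pointwise, then the limit is
holomorphic on the whole domain. -/
theorem pointwise_limit_of_integrably_dominated_holomorphic
    (Ω : Set ℂ) (hΩopen : IsOpen Ω) (hΩconn : IsConnected Ω)
    (f : ℕ → ℂ → ℂ) (F : ℂ → ℂ) (g : ℂ → ℝ)
    (hg0 : ∀ z ∈ Ω, 0 ≤ g z)
    (hgint : IntegrableOn g Ω volume)
    (hf : ∀ j, DifferentiableOn ℂ (f j) Ω)
    (hdom : ∀ j, ∀ z ∈ Ω, ‖f j z‖ ≤ g z)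
    (hconv : ∀ z ∈ Ω, Tendsto (fun j => f j z) atTop (𝓝 (F z))) :
    DifferentiableOn ℂ F Ω := by
  have hmeas : ∀ j, AEStronglyMeasurable (f j) (volume.restrict Ω) := fun j ↦
    (hf j).continuousOn.aestronglyMeasurable hΩopen.measurableSet
  have hlim : ∀ᵐ z ∂volume.restrict Ω, Tendsto (fun j ↦ f j z) atTop (𝓝 (F z)) :=
    ae_restrict_of_forall_mem hΩopen.measurableSet hconv
  have hbound : ∀ j, ∀ᵐ z ∂volume.restrict Ω, ‖f j z‖ ≤ g z := fun j ↦
    ae_restrict_of_forall_mem hΩopen.measurableSet (hdom j)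
  have hfint : ∀ j, IntegrableOn (f j) Ω := fun j ↦ hgint.mono' (hmeas j) (hbound j)
  have hFint : IntegrableOn F Ω := by
    refine hgint.mono' (aestronglyMeasurable_of_tendsto_ae atTop hmeas hlim)
      (ae_restrict_of_forall_mem hΩopen.measurableSet fun z hz ↦ ?_)
    exact le_of_tendsto (hconv z hz).norm (Eventually.of_forall fun j ↦ hdom j z hz)
  have hL1 : Tendsto (fun j ↦ ∫ z in Ω, ‖F z - f j z‖) atTop (𝓝 0) := by
    have h := tendsto_integral_of_dominated_convergence (μ := volume.restrict Ω)
      (F := fun j z ↦ ‖F z - f j z‖) (f := fun _ ↦ (0 : ℝ)) (fun z ↦ ‖F z‖ + g z)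
      (fun j ↦ (hFint.sub (hfint j)).norm.aestronglyMeasurable) (hFint.norm.add hgint)
      (fun j ↦ by
        filter_upwards [hbound j] with z hz
        rw [norm_norm]
        exact (norm_sub_le _ _).trans (by gcongr))
      (by
        filter_upwards [hlim] with z hz
        simpa using (hz.const_sub (F z)).norm)
    simpa using h
  have hmean : ∀ z r, 0 < r → Metric.closedBall z r ⊆ Ω → ∀ j,
      volume.real (Metric.closedBall z r) * ‖F z - f j z‖ ≤ ∫ w in Ω, ‖F w - f j w‖ := by
    intro z r hr hsub j
    have hfj : ∀ k, ∫ w in Metric.closedBall z r, f k w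
        = volume.real (Metric.closedBall z r) • f k z := fun k ↦
      setIntegral_closedBall_of_diffContOnCl hr (((hf k).mono hsub).diffContOnCl_ball subset_rfl)
    have hF : ∫ w in Metric.closedBall z r, F w
        = volume.real (Metric.closedBall z r) • F z := by
      have h := tendsto_integral_of_dominated_convergence g
        (fun k ↦ (hmeas k).mono_set hsub) (hgint.mono_set hsub)
        (fun k ↦ ae_restrict_of_ae_restrict_of_subset hsub (hbound k))
        (ae_restrict_of_ae_restrict_of_subset hsub hlim)
      simp_rw [hfj] at h
      exact tendsto_nhds_unique h ((hconv z (hsub (Metric.mem_closedBall_self hr.le))).const_smul _)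
    calc volume.real (Metric.closedBall z r) * ‖F z - f j z‖
        = ‖∫ w in Metric.closedBall z r, (F w - f j w)‖ := by
          rw [integral_sub (hFint.mono_set hsub) ((hfint j).mono_set hsub), hF, hfj, ← smul_sub,
            norm_smul, Real.norm_of_nonneg measureReal_nonneg]
      _ ≤ ∫ w in Metric.closedBall z r, ‖F w - f j w‖ := norm_integral_le_integral_norm _
      _ ≤ ∫ w in Ω, ‖F w - f j w‖ :=
          setIntegral_mono_set (hFint.sub (hfint j)).norm
            (Eventually.of_forall fun w ↦ norm_nonneg _) hsub.eventuallyLE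
  refine TendstoLocallyUniformlyOn.differentiableOn (F := f) (φ := atTop) ?_
    (Eventually.of_forall hf) hΩopen
  rw [Metric.tendstoLocallyUniformlyOn_iff]
  intro ε hε x hx
  obtain ⟨δ, hδ, hδsub⟩ := Metric.isOpen_iff.1 hΩopen x hx
  have hr : 0 < δ / 2 := half_pos hδ
  set V := volume.real (Metric.closedBall (0 : ℂ) (δ / 2)) with hVdef
  have hV : 0 < V := ENNReal.toReal_pos (Metric.measure_closedBall_pos _ _ hr).ne' measure_closedBall_lt_top.ne
  refine ⟨Metric.ball x (δ / 2), mem_nhdsWithin_of_mem_nhds (Metric.ball_mem_nhds x hr), ?_⟩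
  filter_upwards [hL1.eventually_lt_const (mul_pos hV hε)] with n hn y hy
  have hsub : Metric.closedBall y (δ / 2) ⊆ Ω := fun w hw ↦ hδsub <| by
    rw [Metric.mem_ball] at hy ⊢
    linarith [dist_triangle w y x, Metric.mem_closedBall.1 hw]
  have hVy : volume.real (Metric.closedBall y (δ / 2)) = V := by simp [hVdef, Measure.real]
  have h := hmean y _ hr hsub n
  rw [hVy] at h
  rw [dist_eq_norm]
  exact lt_of_mul_lt_mul_left (h.trans_lt hn) hV.le
end

section
/- Let Ω be a domain (nonempty connected open set) in ℂ, let g be a nonnegative Lebesgue-integrable function on Ω, and let {f_j} be a sequence of holomorphic functions on Ω satisfying |f_j(z)| ≤ g(z) for all j and all z ∈ Ω. Then the family {f_j} is uniformly bounded on each compact subset of Ω: for every compact K ⊆ Ω there is a constant M_K > 0 such that |f_j(z)| ≤ M_K for all j and all z ∈ K. -/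
open Filter Topology MeasureTheory

/-- The area form of the mean value property for complex differentiable functions. -/
theorem DiffContOnCl.setIntegral_ball_eq {E : Type*} [NormedAddCommGroup E] [NormedSpace ℂ E]
    [CompleteSpace E] {f : ℂ → E} {c : ℂ} {R : ℝ} (hR : 0 < R)
    (hf : DiffContOnCl ℂ f (Metric.ball c R)) :
    ∫ z in Metric.ball c R, f z = (Real.pi * R ^ 2) • f c := by
  have hcont : ContinuousOn f (Metric.closedBall c R) := by
    simpa [closure_ball c hR.ne'] using hf.continuousOn
  have hmean : ∀ r ∈ Set.Ioo 0 R,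
      ∫ θ in Set.Ioo (-Real.pi) Real.pi, r • f (circleMap c r θ) =
        (2 * Real.pi * r) • f c := by
    intro r hr
    have havg : Real.circleAverage f c r = f c := DiffContOnCl.circleAverage <| hf.mono <| by
      rw [abs_of_pos hr.1]
      exact Metric.ball_subset_ball hr.2.le
    rw [Real.circleAverage_eq_integral_add (-Real.pi),
      intervalIntegral.integral_comp_add_right (fun θ ↦ f (circleMap c r θ)),
      intervalIntegral.integral_of_le (by linarith [Real.pi_pos]), integral_Ioc_eq_integral_Ioo,
      inv_smul_eq_iff₀ (by positivity)] at havg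
    rw [integral_smul, show Set.Ioo (-Real.pi) Real.pi =
      Set.Ioo (0 + -Real.pi) (2 * Real.pi + -Real.pi) by ring_nf, havg, smul_smul, mul_comm]
  have hint : IntegrableOn (fun p : ℝ × ℝ ↦ p.1 • f (circleMap c p.1 p.2))
      (Set.Ioo 0 R ×ˢ Set.Ioo (-Real.pi) Real.pi) (volume.prod volume) := by
    have hcp : ContinuousOn (fun p : ℝ × ℝ ↦ p.1 • f (circleMap c p.1 p.2))
        (Set.Icc 0 R ×ˢ Set.Icc (-Real.pi) Real.pi) := by
      refine continuousOn_fst.smul (hcont.comp ?_ ?_)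
      · simp only [circleMap]
        fun_prop
      · intro p hp
        simpa [circleMap, abs_of_nonneg hp.1.1] using hp.1.2
    exact (hcp.integrableOn_compact (isCompact_Icc.prod isCompact_Icc)).mono_set
      (Set.prod_mono Set.Ioo_subset_Icc_self Set.Ioo_subset_Icc_self)
  calc
    ∫ z in Metric.ball c R, f z
        = ∫ z, (Metric.ball (0 : ℂ) R).indicator (fun w ↦ f (c + w)) z := by
      rw [← integral_indicator Metric.isOpen_ball.measurableSet,
        ← integral_add_left_eq_self _ c]
      congr 1 with z
      simp [Set.indicator]
    _ = ∫ p in polarCoord.target, (Set.Ioo 0 R ×ˢ Set.Ioo (-Real.pi) Real.pi).indicator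
          (fun p : ℝ × ℝ ↦ p.1 • f (circleMap c p.1 p.2)) p := by
      rw [← Complex.integral_comp_polarCoord_symm]
      refine setIntegral_congr_fun polarCoord.open_target.measurableSet fun p hp ↦ ?_
      obtain ⟨hp₁, hp₂⟩ := hp
      have hnorm : ‖Complex.polarCoord.symm p‖ = p.1 := by
        rw [Complex.norm_polarCoord_symm, abs_of_pos hp₁]
      have hmap : c + Complex.polarCoord.symm p = circleMap c p.1 p.2 := by
        simp [circleMap, Complex.exp_mul_I]
      by_cases hlt : p.1 < R
      · have hmem : p ∈ Set.Ioo 0 R ×ˢ Set.Ioo (-Real.pi) Real.pi := ⟨⟨hp₁, hlt⟩, hp₂⟩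
        rw [Set.indicator_of_mem (by rwa [mem_ball_zero_iff, hnorm]),
          Set.indicator_of_mem hmem, hmap]
      · rw [Set.indicator_of_notMem (by rwa [mem_ball_zero_iff, hnorm]),
          Set.indicator_of_notMem (fun h ↦ hlt h.1.2), smul_zero]
    _ = ∫ p in Set.Ioo 0 R ×ˢ Set.Ioo (-Real.pi) Real.pi, p.1 • f (circleMap c p.1 p.2) := by
      rw [setIntegral_indicator (measurableSet_Ioo.prod measurableSet_Ioo),
        polarCoord_target, Set.inter_eq_right.2 (Set.prod_mono Set.Ioo_subset_Ioi_self subset_rfl)]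
    _ = ∫ r in Set.Ioo 0 R, (2 * Real.pi * r) • f c := by
      rw [Measure.volume_eq_prod, setIntegral_prod _ hint]
      exact setIntegral_congr_fun measurableSet_Ioo hmean
    _ = (Real.pi * R ^ 2) • f c := by
      rw [integral_smul_const, ← integral_Ioc_eq_integral_Ioo,
        ← intervalIntegral.integral_of_le hR.le, intervalIntegral.integral_const_mul, integral_id]
      congr 1
      ring

/-- A family of holomorphic functions on a planar domain dominated by a fixed
nonnegative Lebesgue-integrable function is uniformly bounded on each compact subset. -/
theorem integrably_dominated_holomorphic_locally_uniformly_bounded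
    (Ω : Set ℂ) (hΩopen : IsOpen Ω) (hΩconn : IsConnected Ω)
    (f : ℕ → ℂ → ℂ) (g : ℂ → ℝ)
    (hg0 : ∀ z ∈ Ω, 0 ≤ g z)
    (hgint : IntegrableOn g Ω volume)
    (hf : ∀ j, DifferentiableOn ℂ (f j) Ω)
    (hdom : ∀ j, ∀ z ∈ Ω, ‖f j z‖ ≤ g z) :
    ∀ K ⊆ Ω, IsCompact K → ∃ M > 0, ∀ j, ∀ z ∈ K, ‖f j z‖ ≤ M := by
  intro K hKΩ hK
  obtain ⟨δ, hδ, hδΩ⟩ := hK.exists_cthickening_subset_open hΩopen hKΩ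
  have hg_nonneg : 0 ≤ ∫ w in Ω, g w := setIntegral_nonneg hΩopen.measurableSet hg0
  refine ⟨(∫ w in Ω, g w) / (Real.pi * δ ^ 2) + 1, by positivity, fun j z hz ↦ ?_⟩
  have hclosed : Metric.closedBall z δ ⊆ Ω :=
    (Metric.closedBall_subset_cthickening hz δ).trans hδΩ
  have hball : Metric.ball z δ ⊆ Ω := Metric.ball_subset_closedBall.trans hclosed
  have hbound : Real.pi * δ ^ 2 * ‖f j z‖ ≤ ∫ w in Ω, g w := calc
    Real.pi * δ ^ 2 * ‖f j z‖ = ‖∫ w in Metric.ball z δ, f j w‖ := by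
      rw [((hf j).mono (closure_ball z hδ.ne' ▸ hclosed)).diffContOnCl.setIntegral_ball_eq hδ,
        norm_smul, Real.norm_of_nonneg (by positivity)]
    _ ≤ ∫ w in Metric.ball z δ, g w :=
      norm_integral_le_of_norm_le (hgint.mono_set hball) <|
        ae_restrict_of_forall_mem Metric.isOpen_ball.measurableSet fun w hw ↦ hdom j w (hball hw)
    _ ≤ ∫ w in Ω, g w :=
      setIntegral_mono_set hgint (ae_restrict_of_forall_mem hΩopen.measurableSet hg0)
        hball.eventuallyLE
  have : ‖f j z‖ ≤ (∫ w in Ω, g w) / (Real.pi * δ ^ 2) := by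
    rw [le_div_iff₀ (by positivity)]
    linarith
  linarith
end

section
/- Let {f_j} be a sequence of schlicht functions on the unit disc D = {z ∈ ℂ : |z| < 1} that converges pointwise on D to a limit function f. Then f is holomorphic on all of D. -/
open Filter Topology Metric

/-- A function is schlicht on the unit disc if it is holomorphic and injective there,
fixes the origin, and has derivative `1` at the origin. -/
def Schlicht (f : ℂ → ℂ) : Prop :=
  DifferentiableOn ℂ f (ball (0 : ℂ) 1) ∧ Set.InjOn f (ball (0 : ℂ) 1) ∧
    f 0 = 0 ∧ deriv f 0 = 1

/-- A nonvanishing holomorphic function on a disc has a holomorphic logarithm. -/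
theorem DifferentiableOn.exists_exp_eq_of_ne_zero {g : ℂ → ℂ} {c : ℂ} {r : ℝ}
    (hr : 0 < r) (hg : DifferentiableOn ℂ g (ball c r)) (hg₀ : ∀ z ∈ ball c r, g z ≠ 0) :
    ∃ L : ℂ → ℂ, DifferentiableOn ℂ L (ball c r) ∧ L c = Complex.log (g c) ∧
      ∀ z ∈ ball c r, Complex.exp (L z) = g z := by
  have hc : c ∈ ball c r := mem_ball_self hr
  obtain ⟨L, hLc, hL⟩ := ((hg.deriv isOpen_ball).div hg hg₀).isExactOn_ball.with_val_at c
    (Complex.log (g c))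
  have hLd : DifferentiableOn ℂ L (ball c r) :=
    fun z hz => (hL z hz).differentiableAt.differentiableWithinAt
  refine ⟨L, hLd, hLc, fun z hz => ?_⟩
  have hconst : g z * Complex.exp (-L z) = g c * Complex.exp (-L c) := by
    refine isOpen_ball.is_const_of_deriv_eq_zero (f := fun z => g z * Complex.exp (-L z))
      (convex_ball c r).isPreconnected (hg.mul hLd.neg.cexp) (fun x hx => ?_) hz hc
    have hgx := (hg.differentiableAt (isOpen_ball.mem_nhds hx)).hasDerivAt
    have h := (hgx.mul (hL x hx).neg.cexp).deriv
    have hx₀ := hg₀ x hx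
    refine Eq.trans h ?_
    simp only [Pi.div_apply, Pi.zero_apply, Pi.neg_apply]
    field_simp
    ring
  rw [hLc, Complex.exp_neg, Complex.exp_neg, Complex.exp_log (hg₀ c hc),
    mul_inv_cancel₀ (hg₀ c hc)] at hconst
  exact (eq_of_div_eq_one (by rw [div_eq_mul_inv, hconst])).symm

/-- An injective holomorphic function on a disc is open. -/
theorem DifferentiableOn.isOpen_image_of_injOn {f : ℂ → ℂ} {c : ℂ} {r : ℝ} (hr : 0 < r)
    (hf : DifferentiableOn ℂ f (ball c r)) (hi : Set.InjOn f (ball c r)) {s : Set ℂ}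
    (hs : s ⊆ ball c r) (hso : IsOpen s) : IsOpen (f '' s) := by
  refine ((hf.analyticOnNhd isOpen_ball).is_constant_or_isOpen
    (convex_ball c r).isPreconnected).resolve_left ?_ s hs hso
  rintro ⟨w, hw⟩
  have hc : c ∈ ball c r := mem_ball_self hr
  have hc' : c + (r / 2 : ℝ) ∈ ball c r := by
    rw [mem_ball, dist_self_add_left, Complex.norm_real, Real.norm_of_nonneg (by positivity)]
    linarith
  have h := hi hc hc' ((hw _ hc).trans (hw _ hc').symm)
  have h₀ : ((r / 2 : ℝ) : ℂ) = 0 := by simpa using h.symm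
  rw [Complex.ofReal_eq_zero] at h₀
  linarith

/-- The inverse of an injective holomorphic function on a disc is continuous. -/
theorem DifferentiableOn.continuousOn_invFunOn {f : ℂ → ℂ} {c : ℂ} {r : ℝ} (hr : 0 < r)
    (hf : DifferentiableOn ℂ f (ball c r)) (hi : Set.InjOn f (ball c r)) :
    ContinuousOn (Function.invFunOn f (ball c r)) (f '' ball c r) := by
  refine IsOpenMap.continuousOn_image_of_leftInvOn (fun t ht => ?_) hi.leftInvOn_invFunOn
  have h := hf.isOpen_image_of_injOn hr hi (Subtype.coe_image_subset _ t)
    (isOpen_ball.isOpenMap_subtype_val t ht)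
  rwa [Set.image_image] at h

namespace Schlicht

variable {f : ℂ → ℂ}

theorem ne_zero (hf : Schlicht f) {z : ℂ} (hz : z ∈ ball (0 : ℂ) 1) (hz₀ : z ≠ 0) :
    f z ≠ 0 := by
  obtain ⟨-, hi, h0, -⟩ := hf
  exact fun h => hz₀ (hi hz (mem_ball_self one_pos) (h.trans h0.symm))

/-- The image of a schlicht function contains no disc about the origin of radius
greater than `1`. -/
theorem radius_le_one (hf : Schlicht f) {r : ℝ}
    (hr : ball (0 : ℂ) r ⊆ f '' ball (0 : ℂ) 1) : r ≤ 1 := by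
  by_contra! h1r
  obtain ⟨s, h1s, hsr⟩ := exists_between h1r
  have hne := fun z hz hz₀ => hf.ne_zero (z := z) hz hz₀
  obtain ⟨hd, hi, h0, h1⟩ := hf
  have hmem0 : (0 : ℂ) ∈ ball (0 : ℂ) 1 := mem_ball_self one_pos
  have hsub : closedBall (0 : ℂ) s ⊆ f '' ball (0 : ℂ) 1 :=
    (closedBall_subset_ball hsr).trans hr
  set φ := Function.invFunOn f (ball (0 : ℂ) 1)
  let K := φ '' closedBall (0 : ℂ) s
  have hKc : IsCompact K := (isCompact_closedBall _ _).image_of_continuousOn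
    ((hd.continuousOn_invFunOn one_pos hi).mono hsub)
  have hKD : K ⊆ ball (0 : ℂ) 1 := by
    rintro _ ⟨y, hy, rfl⟩
    exact Function.invFunOn_mem (hsub hy)
  let U := ball (0 : ℂ) 1 ∩ f ⁻¹' ball 0 s
  have hUo : IsOpen U := hd.continuousOn.isOpen_inter_preimage isOpen_ball isOpen_ball
  have hUK : U ⊆ K := fun z hz =>
    ⟨f z, ball_subset_closedBall hz.2, hi.leftInvOn_invFunOn hz.1⟩
  have hclK : closure U ⊆ K := closure_minimal hUK hKc.isClosed
  have hds : DifferentiableOn ℂ (dslope f 0) (ball (0 : ℂ) 1) :=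
    (Complex.differentiableOn_dslope (isOpen_ball.mem_nhds hmem0)).2 hd
  have hds₀ : ∀ z ∈ ball (0 : ℂ) 1, dslope f 0 z ≠ 0 := by
    intro z hz
    rcases eq_or_ne z 0 with rfl | hz₀
    · simp [h1]
    · rw [dslope_of_ne _ hz₀, slope_def_field, h0, sub_zero, sub_zero]
      exact div_ne_zero (hne z hz hz₀) hz₀
  have hq : DiffContOnCl ℂ (fun z => (dslope f 0 z)⁻¹) U :=
    DifferentiableOn.diffContOnCl ((hds.inv hds₀).mono (hclK.trans hKD))
  have hfr : ∀ z ∈ frontier U, ‖(dslope f 0 z)⁻¹‖ ≤ s⁻¹ := by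
    intro z hz
    have hzD : z ∈ ball (0 : ℂ) 1 := hKD (hclK hz.1)
    have hfz : s ≤ ‖f z‖ := by
      by_contra! hlt
      refine hz.2 ?_
      rw [hUo.interior_eq]
      exact ⟨hzD, by simpa using hlt⟩
    have hz₀ : z ≠ 0 := by
      rintro rfl
      rw [h0, norm_zero] at hfz
      linarith
    rw [dslope_of_ne _ hz₀, slope_def_field, h0, sub_zero, sub_zero, inv_div, norm_div,
      ← one_div]
    have hz1 : ‖z‖ ≤ 1 := (mem_ball_zero_iff.1 hzD).le
    gcongr
  have h := Complex.norm_le_of_forall_mem_frontier_norm_le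
    (isBounded_ball.subset Set.inter_subset_left) hq hfr
    (subset_closure (⟨hmem0, by simp [h0]; linarith⟩ : (0 : ℂ) ∈ U))
  rw [dslope_same, h1, inv_one, norm_one] at h
  exact absurd (inv_lt_one_of_one_lt₀ h1s) (not_lt.2 h)

/-- A schlicht function omits a value `w ≠ 0` of norm at most `1` such that its image
contains the disc of radius `‖w‖` about the origin. -/
theorem exists_omitted_value (hf : Schlicht f) :
    ∃ w : ℂ, w ≠ 0 ∧ ‖w‖ ≤ 1 ∧ w ∉ f '' ball (0 : ℂ) 1 ∧
      ball (0 : ℂ) ‖w‖ ⊆ f '' ball (0 : ℂ) 1 := by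
  have hcl : IsClosed (f '' ball (0 : ℂ) 1)ᶜ :=
    (hf.1.isOpen_image_of_injOn one_pos hf.2.1 subset_rfl isOpen_ball).isClosed_compl
  have hne : (f '' ball (0 : ℂ) 1)ᶜ.Nonempty := by
    by_contra h
    rw [Set.not_nonempty_iff_eq_empty, Set.compl_empty_iff] at h
    have := hf.radius_le_one (r := 2) (h ▸ Set.subset_univ _)
    norm_num at this
  obtain ⟨w, hw, hdist⟩ := hcl.exists_infDist_eq_dist hne 0
  rw [dist_zero_left] at hdist
  have hball : ball (0 : ℂ) ‖w‖ ⊆ f '' ball (0 : ℂ) 1 := by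
    intro y hy
    by_contra hy'
    have := infDist_le_dist_of_mem (x := 0) (Set.mem_compl hy')
    rw [hdist, dist_zero_left] at this
    exact absurd (mem_ball_zero_iff.1 hy) (not_lt.2 this)
  refine ⟨w, ?_, hf.radius_le_one hball, hw, hball⟩
  rintro rfl
  exact hw ⟨0, mem_ball_self one_pos, hf.2.2.1⟩

/-- A square root of `1 - f / w`, for an omitted value `w` of minimal norm, stays away
from `-1`. -/
theorem le_norm_sqrt_add_one (hf : Schlicht f) {w : ℂ} (hw : w ≠ 0)
    (hball : ball (0 : ℂ) ‖w‖ ⊆ f '' ball (0 : ℂ) 1) {ψ : ℂ → ℂ}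
    (hψ : ContinuousOn ψ (ball 0 1)) (hψ₀ : ψ 0 = 1)
    (hψ₂ : ∀ z ∈ ball (0 : ℂ) 1, ψ z ^ 2 = 1 - f z / w) {z : ℂ}
    (hz : z ∈ ball (0 : ℂ) 1) : 1 / 3 ≤ ‖ψ z + 1‖ := by
  obtain ⟨hd, hi, h0, -⟩ := hf
  by_contra! hlt
  have hleft := hi.leftInvOn_invFunOn
  set φ := Function.invFunOn f (ball (0 : ℂ) 1)
  have hmaps : Set.MapsTo φ (ball 0 ‖w‖) (ball 0 1) :=
    fun y hy => Function.invFunOn_mem (hball hy)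
  have hright : ∀ y ∈ ball (0 : ℂ) ‖w‖, f (φ y) = y :=
    fun y hy => Function.invFunOn_eq (hball hy)
  have hmem0 : (0 : ℂ) ∈ ball (0 : ℂ) ‖w‖ := mem_ball_self (norm_pos_iff.2 hw)
  have hφ0 : φ 0 = 0 := by
    conv_lhs => rw [← h0]
    exact hleft (mem_ball_self one_pos)
  have hcont : ContinuousOn (fun y => (ψ (φ y)).re) (ball 0 ‖w‖) :=
    Complex.continuous_re.comp_continuousOn
      (hψ.comp ((hd.continuousOn_invFunOn one_pos hi).mono hball) hmaps)
  have hre : ∀ y ∈ ball (0 : ℂ) ‖w‖, (ψ (φ y)).re ≠ 0 := by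
    intro y hy hzero
    have hsq := hψ₂ _ (hmaps hy)
    rw [hright y hy] at hsq
    have h1 : ‖y / w‖ < 1 := by
      rw [norm_div, div_lt_one (norm_pos_iff.2 hw)]
      exact mem_ball_zero_iff.1 hy
    have h2 := (Complex.re_le_norm (y / w)).trans_lt h1
    have h3 := congrArg Complex.re hsq
    rw [pow_two, Complex.mul_re, hzero, Complex.sub_re, Complex.one_re] at h3
    nlinarith [mul_self_nonneg (ψ (φ y)).im]
  have hfac : ‖f z / w‖ < 1 := by
    have h1 : f z / w = -((ψ z + 1) * ((ψ z + 1) - 2)) := by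
      linear_combination hψ₂ z hz
    have h2 : ‖ψ z + 1 - 2‖ ≤ ‖ψ z + 1‖ + 2 := by
      simpa using norm_sub_le (ψ z + 1) 2
    rw [h1, norm_neg, norm_mul]
    nlinarith [norm_nonneg (ψ z + 1)]
  have hfz : f z ∈ ball (0 : ℂ) ‖w‖ := by
    rwa [norm_div, div_lt_one (norm_pos_iff.2 hw), ← mem_ball_zero_iff] at hfac
  have hneg : (ψ (φ (f z))).re < 0 := by
    rw [hleft hz]
    have := (Complex.re_le_norm (ψ z + 1)).trans_lt hlt
    rw [Complex.add_re, Complex.one_re] at this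
    linarith
  have hpos : 0 < (ψ (φ 0)).re := by simp [hφ0, hψ₀]
  obtain ⟨y, hy, hy0⟩ := (convex_ball (0 : ℂ) ‖w‖).isPreconnected.intermediate_value
    hfz hmem0 hcont ⟨hneg.le, hpos.le⟩
  exact hre y hy hy0

/-- Schlicht functions are uniformly bounded on smaller discs. -/
theorem norm_le (hf : Schlicht f) {r : ℝ} (hr : r < 1) {z : ℂ} (hz : z ∈ closedBall 0 r) :
    ‖f z‖ ≤ (Real.exp (6 / (1 - r)) + 1) ^ 2 + 1 := by
  obtain ⟨w, hw, hw1, hom, hball⟩ := hf.exists_omitted_value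
  have hmem0 : (0 : ℂ) ∈ ball (0 : ℂ) 1 := mem_ball_self one_pos
  have hd : DifferentiableOn ℂ (fun z => 1 - f z / w) (ball 0 1) :=
    (hf.1.div_const w).const_sub 1
  obtain ⟨L, hLd, hL0, hL⟩ := hd.exists_exp_eq_of_ne_zero one_pos fun x hx h =>
    hom ⟨x, hx, by rw [sub_eq_zero, eq_div_iff hw, one_mul] at h; exact h.symm⟩
  set ψ : ℂ → ℂ := fun z => Complex.exp (L z / 2) with hψ
  have hψd : DifferentiableOn ℂ ψ (ball 0 1) := (hLd.div_const 2).cexp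
  have hψ₂ : ∀ x ∈ ball (0 : ℂ) 1, ψ x ^ 2 = 1 - f x / w := by
    intro x hx
    rw [← hL x hx, hψ, ← Complex.exp_nat_mul]
    congr 1
    push_cast
    ring
  have hψ₀ : ψ 0 = 1 := by simp [hψ, hL0, hf.2.2.1]
  have hlow := fun x hx =>
    hf.le_norm_sqrt_add_one hw hball hψd.continuousOn hψ₀ hψ₂ (z := x) hx
  obtain ⟨v, hvd, hv0, hv⟩ := (hψd.add_const 1).exists_exp_eq_of_ne_zero one_pos
    fun x hx h => by have := hlow x hx; rw [h, norm_zero] at this; norm_num at this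
  have hmaps : Set.MapsTo (fun x => -v x) (ball 0 1) {x | x.re ≤ 2} := by
    intro x hx
    have h1 := hlow x hx
    rw [← hv x hx, Complex.norm_exp] at h1
    have h2 : Real.exp (-(v x).re) ≤ 3 := by
      rw [Real.exp_neg]
      exact inv_le_of_inv_le₀ (by norm_num) (by norm_num at h1 ⊢; exact h1)
    have h3 := Real.add_one_le_exp (-(v x).re)
    change (-v x).re ≤ 2
    rw [Complex.neg_re]
    linarith
  have hzr : ‖z‖ ≤ r := mem_closedBall_zero_iff.1 hz
  have hz1 : z ∈ ball (0 : ℂ) 1 := mem_ball_zero_iff.2 (hzr.trans_lt hr)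
  have hBC := Complex.borelCaratheodory two_pos hvd.neg hmaps one_pos hz1
  have hv0' : ‖-v 0‖ ≤ 1 := by
    rw [hv0, hψ₀, norm_neg, show (1 + 1 : ℂ) = ((2 : ℝ) : ℂ) by norm_num,
      ← Complex.ofReal_log (by norm_num), Complex.norm_real,
      Real.norm_of_nonneg (Real.log_nonneg (by norm_num))]
    linarith [Real.log_two_lt_d9]
  have hvz : ‖v z‖ ≤ 6 / (1 - r) := by
    rw [← norm_neg]
    refine hBC.trans ?_
    simp only [Pi.neg_apply]
    rw [← add_div]
    have := norm_nonneg z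
    have := norm_nonneg (-v 0)
    exact div_le_div₀ (by norm_num) (by nlinarith) (by linarith) (by linarith)
  have hψz : ‖ψ z‖ ≤ Real.exp (6 / (1 - r)) + 1 := by
    have h1 : ‖ψ z + 1‖ ≤ Real.exp (6 / (1 - r)) := by
      rw [← hv z hz1, Complex.norm_exp]
      exact Real.exp_le_exp.2 ((Complex.re_le_norm _).trans hvz)
    have h2 := norm_sub_le (ψ z + 1) 1
    rw [add_sub_cancel_right, norm_one] at h2
    linarith
  have hfz : f z = w * (1 - ψ z ^ 2) := by
    rw [hψ₂ z hz1]
    field_simp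
    ring
  calc ‖f z‖ ≤ 1 * (1 + ‖ψ z‖ ^ 2) := by
        rw [hfz, norm_mul]
        gcongr
        exact (norm_sub_le _ _).trans_eq (by rw [norm_one, norm_pow])
    _ ≤ (Real.exp (6 / (1 - r)) + 1) ^ 2 + 1 := by
        rw [one_mul, add_comm]
        gcongr

end Schlicht

/-- A uniformly bounded pointwise limit of holomorphic functions on a disc is holomorphic. -/
theorem differentiableOn_ball_of_tendsto_of_norm_le {f : ℕ → ℂ → ℂ} {F : ℂ → ℂ} {c : ℂ}
    {r M : ℝ} (hr : 0 < r) (hf : ∀ n, DiffContOnCl ℂ (f n) (ball c r))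
    (hM : ∀ n, ∀ z ∈ closedBall c r, ‖f n z‖ ≤ M)
    (hconv : ∀ z ∈ closedBall c r, Tendsto (fun n => f n z) atTop (𝓝 (F z))) :
    DifferentiableOn ℂ F (ball c r) := by
  have hmem : ∀ θ, circleMap c r θ ∈ closedBall c r :=
    fun θ => sphere_subset_closedBall (circleMap_mem_sphere c hr.le θ)
  have hfc : ∀ n, Continuous fun θ => f n (circleMap c r θ) := fun n => by
    have h := (hf n).continuousOn
    rw [closure_ball c hr.ne'] at h
    exact h.comp_continuous (continuous_circleMap c r) hmem
  have hFM : ∀ z ∈ closedBall c r, ‖F z‖ ≤ M := fun z hz =>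
    le_of_tendsto (hconv z hz).norm (.of_forall fun n => hM n z hz)
  have hFint : CircleIntegrable F c r := by
    refine (intervalIntegrable_const (c := M)).mono_fun
      (aestronglyMeasurable_of_tendsto_ae atTop
        (fun n => (hfc n).aestronglyMeasurable)
        (.of_forall fun θ => hconv _ (hmem θ))) (.of_forall fun θ => ?_)
    exact (hFM _ (hmem θ)).trans (le_abs_self M)
  lift r to NNReal using hr.le
  have hana := (hasFPowerSeriesOn_cauchy_integral hFint (by exact_mod_cast hr)).differentiableOn
  rw [Metric.eball_coe] at hana
  refine hana.congr fun w hw => ?_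
  refine tendsto_nhds_unique (hconv w (ball_subset_closedBall hw)) ?_
  have hcauchy := fun n => (hf n).two_pi_i_inv_smul_circleIntegral_sub_inv_smul hw
  refine Tendsto.congr hcauchy (Tendsto.const_smul ?_ _)
  have hker : Continuous fun θ => deriv (circleMap c r) θ * (circleMap c r θ - w)⁻¹ := by
    have hne : ∀ θ, circleMap c r θ - w ≠ 0 :=
      fun θ => sub_ne_zero.2 (circleMap_ne_mem_ball hw θ)
    have hcm := continuous_circleMap c r
    simp only [deriv_circleMap]
    have hcm0 := continuous_circleMap 0 r
    fun_prop (disch := assumption)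
  refine intervalIntegral.tendsto_integral_filter_of_dominated_convergence
    (fun θ => ‖deriv (circleMap c r) θ * (circleMap c r θ - w)⁻¹‖ * M)
    (.of_forall fun n => ?_) (.of_forall fun n => .of_forall fun θ _ => ?_)
    ((hker.norm.mul continuous_const).intervalIntegrable _ _)
    (.of_forall fun θ _ => ?_)
  · simp only [smul_eq_mul, ← mul_assoc]
    exact (hker.mul (hfc n)).aestronglyMeasurable
  · simp only [smul_eq_mul, ← mul_assoc]
    rw [norm_mul]
    gcongr
    exact hM n _ (hmem θ)
  · exact ((hconv _ (hmem θ)).const_smul _).const_smul _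

/-- A pointwise limit of schlicht functions on the unit disc is holomorphic on the
whole disc. -/
theorem pointwise_limit_of_schlicht_is_holomorphic
    (f : ℕ → ℂ → ℂ) (F : ℂ → ℂ)
    (hf : ∀ j, Schlicht (f j))
    (hconv : ∀ z ∈ ball (0 : ℂ) 1, Tendsto (fun j => f j z) atTop (𝓝 (F z))) :
    DifferentiableOn ℂ F (ball (0 : ℂ) 1) := by
  intro z hz
  obtain ⟨r, hzr, hr1⟩ := exists_between (mem_ball_zero_iff.1 hz)
  have hr0 : 0 < r := (norm_nonneg z).trans_lt hzr
  have hsub : closedBall (0 : ℂ) r ⊆ ball 0 1 := closedBall_subset_ball hr1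
  have h := differentiableOn_ball_of_tendsto_of_norm_le hr0
    (fun n => ((hf n).1.mono (closure_ball_subset_closedBall.trans hsub)).diffContOnCl)
    (fun n x hx => (hf n).norm_le hr1 hx) (fun x hx => hconv x (hsub hx))
  exact (h.differentiableAt (isOpen_ball.mem_nhds
    (mem_ball_zero_iff.2 hzr))).differentiableWithinAt
end

section
/- Every schlicht function f on the unit disc D = {z ∈ ℂ : |z| < 1} satisfies the growth estimate |f(z)| ≤ |z|/(1 − |z|)² for all z ∈ D. -/
open Metric

open MeasureTheory Set Real in
/-- The integral of a radial function over an annulus. -/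
lemma integral_annulus_radial {δ r : ℝ} (hδ : 0 < δ) (hr : δ < r) (ψ : ℝ → ℝ) :
    ∫ z in {z : ℂ | ‖z‖ ∈ Ioo δ r}, ψ ‖z‖ = 2 * π * ∫ y in δ..r, y * ψ y := by
  have hm : MeasurableSet {z : ℂ | ‖z‖ ∈ Ioo δ r} := measurableSet_Ioo.preimage measurable_norm
  rw [← integral_indicator hm]
  have h := integral_fun_norm_addHaar (volume : Measure ℂ) ((Ioo δ r).indicator ψ)
  have e : (fun z : ℂ => (Ioo δ r).indicator ψ ‖z‖) =
      {z : ℂ | ‖z‖ ∈ Ioo δ r}.indicator fun z => ψ ‖z‖ := by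
    ext z; simp [indicator]
  rw [e] at h
  rw [h, intervalIntegral.integral_of_le hr.le, integral_Ioc_eq_integral_Ioo]
  have h2 : ∫ y in Ioi (0 : ℝ), y ^ (Module.finrank ℝ ℂ - 1) • (Ioo δ r).indicator ψ y =
      ∫ y in Ioo δ r, y * ψ y := by
    rw [← integral_indicator measurableSet_Ioo, ← integral_indicator measurableSet_Ioi]
    congr 1
    ext y
    by_cases hy : y ∈ Ioo δ r
    · have : 0 < y := hδ.trans hy.1
      simp [hy, this]
    · simp [hy, indicator]
  rw [h2]
  simp [Measure.real, mul_assoc]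

open MeasureTheory Set Real in
lemma integral_circle_re_eq_zero {h : ℂ → ℂ} (hh : DifferentiableOn ℂ h (ball 0 1)) (h0 : h 0 = 0)
    {ρ : ℝ} (hρ : 0 < ρ) (hρ1 : ρ < 1) : ∫ θ in Ioo (-π) π, (h (circleMap 0 ρ θ)).re = 0 := by
  have hsub : closedBall (0 : ℂ) ρ ⊆ ball 0 1 := closedBall_subset_ball hρ1
  have hd : DiffContOnCl ℂ h (ball 0 |ρ|) := by
    rw [abs_of_pos hρ]
    exact (hh.mono (closure_ball_subset_closedBall.trans hsub)).diffContOnCl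
  have h1 := hd.circleAverage
  rw [circleAverage_def, h0, smul_eq_zero] at h1
  have h2 : ∫ θ in (0 : ℝ)..2 * π, h (circleMap 0 ρ θ) = 0 := h1.resolve_left (by positivity)
  have hp : Function.Periodic (fun θ => h (circleMap 0 ρ θ)) (2 * π) := fun θ => by
    simp [periodic_circleMap 0 ρ θ]
  have h3 := hp.intervalIntegral_add_eq (-π) 0
  rw [zero_add, h2, show -π + 2 * π = π by ring,
    intervalIntegral.integral_of_le (by linarith [pi_pos]), integral_Ioc_eq_integral_Ioo] at h3
  have hc : Continuous fun θ => h (circleMap 0 ρ θ) :=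
    hh.continuousOn.comp_continuous (continuous_circleMap 0 ρ) fun θ =>
      hsub (circleMap_mem_closedBall 0 hρ.le θ)
  have hi : IntegrableOn (fun θ => h (circleMap 0 ρ θ)) (Ioo (-π) π) :=
    (hc.integrableOn_Icc).mono_set Ioo_subset_Icc_self
  have h4 := Complex.reCLM.integral_comp_comm hi
  simp only [Complex.reCLM_apply] at h4
  rw [h4, h3]; rfl

open MeasureTheory Set Real in
lemma integral_annulus_re_eq_zero {h : ℂ → ℂ} (hh : DifferentiableOn ℂ h (ball 0 1)) (h0 : h 0 = 0)
    {δ r : ℝ} (hδ : 0 < δ) (hr1 : r < 1) {φ : ℝ → ℝ}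
    (hφ : ContinuousOn φ (Icc δ r)) :
    ∫ z in {z : ℂ | ‖z‖ ∈ Ioo δ r}, φ ‖z‖ * (h z).re = 0 := by
  have hm : MeasurableSet {z : ℂ | ‖z‖ ∈ Ioo δ r} := measurableSet_Ioo.preimage measurable_norm
  rw [← integral_indicator hm, ← Complex.integral_comp_polarCoord_symm]
  have hsymm : ∀ p : ℝ × ℝ, Complex.polarCoord.symm p = circleMap 0 p.1 p.2 := fun p => by
    rw [Complex.polarCoord_symm_apply, circleMap_zero, Complex.exp_mul_I]; simp
  have hS : Ioo δ r ×ˢ Ioo (-π) π ⊆ polarCoord.target :=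
    prod_mono (fun x hx => hδ.trans hx.1) subset_rfl
  have hnorm : ∀ p ∈ polarCoord.target, ‖circleMap 0 p.1 p.2‖ = p.1 := fun p hp => by
    have : 0 < p.1 := hp.1
    simp [abs_of_pos this]
  rw [setIntegral_eq_of_subset_of_forall_sdiff_eq_zero polarCoord.open_target.measurableSet hS]
  · have hcont : ContinuousOn (fun p : ℝ × ℝ => p.1 * (φ p.1 * (h (circleMap 0 p.1 p.2)).re))
        (Icc δ r ×ˢ Icc (-π) π) := by
      have c1 : ContinuousOn (fun p : ℝ × ℝ => φ p.1) (Icc δ r ×ˢ Icc (-π) π) :=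
        hφ.comp continuousOn_fst fun p hp => hp.1
      have c2 : ContinuousOn (fun p : ℝ × ℝ => h (circleMap 0 p.1 p.2))
          (Icc δ r ×ˢ Icc (-π) π) := by
        refine hh.continuousOn.comp (by unfold circleMap; fun_prop) fun p hp => ?_
        have : 0 < p.1 := hδ.trans_le hp.1.1
        simpa [abs_of_pos this] using hp.1.2.trans_lt hr1
      exact continuousOn_fst.mul (c1.mul (Complex.continuous_re.comp_continuousOn c2))
    have h_int : IntegrableOn (fun p : ℝ × ℝ => p.1 * (φ p.1 * (h (circleMap 0 p.1 p.2)).re))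
        (Ioo δ r ×ˢ Ioo (-π) π) (volume.prod volume) :=
      (hcont.integrableOn_compact (isCompact_Icc.prod isCompact_Icc)).mono_set
        (prod_mono Ioo_subset_Icc_self Ioo_subset_Icc_self)
    have : ∫ p in Ioo δ r ×ˢ Ioo (-π) π, p.1 • {z : ℂ | ‖z‖ ∈ Ioo δ r}.indicator
        (fun z => φ ‖z‖ * (h z).re) (Complex.polarCoord.symm p) =
        ∫ p in Ioo δ r ×ˢ Ioo (-π) π, p.1 * (φ p.1 * (h (circleMap 0 p.1 p.2)).re) := by
      refine setIntegral_congr_fun (measurableSet_Ioo.prod measurableSet_Ioo) fun p hp => ?_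
      have hn := hnorm p (hS hp)
      have hmem : circleMap 0 p.1 p.2 ∈ {z : ℂ | ‖z‖ ∈ Ioo δ r} := by
        rw [mem_ofPred_eq, hn]; exact hp.1
      simp only [hsymm, indicator_of_mem hmem, hn, smul_eq_mul]
    rw [this, Measure.volume_eq_prod, setIntegral_prod _ h_int]
    refine setIntegral_eq_zero_of_forall_eq_zero fun ρ hρ => ?_
    simp only [integral_const_mul]
    rw [integral_circle_re_eq_zero hh h0 (hδ.trans hρ.1) (hρ.2.trans hr1)]
    simp
  · intro p hp
    have hn := hnorm p hp.1
    have hmem : circleMap 0 p.1 p.2 ∉ {z : ℂ | ‖z‖ ∈ Ioo δ r} := by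
      rw [mem_ofPred_eq, hn]; exact fun hh => hp.2 ⟨hh, hp.1.2⟩
    simp only [hsymm, indicator_of_notMem hmem, smul_zero]

lemma det_restrictScalars_toSpanSingleton (c : ℂ) :
    ((ContinuousLinearMap.toSpanSingleton ℂ c).restrictScalars ℝ : ℂ →L[ℝ] ℂ).det = ‖c‖ ^ 2 := by
  have h : (((ContinuousLinearMap.toSpanSingleton ℂ c).restrictScalars ℝ : ℂ →L[ℝ] ℂ) : ℂ →ₗ[ℝ] ℂ) =
      Algebra.lmul ℝ ℂ c := by
    ext; simp [mul_comm]
  rw [ContinuousLinearMap.det, h, ← Complex.normSq_eq_norm_sq]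
  exact DFunLike.congr_fun Algebra.norm_complex_eq c

open MeasureTheory Set Real in
lemma integral_weight {δ : ℝ} (hδ : 0 < δ) :
    Integrable (fun u : ℂ => max 0 (1 / ‖u‖ ^ 3 - δ / ‖u‖ ^ 4)) ∧
    ∫ u : ℂ, max 0 (1 / ‖u‖ ^ 3 - δ / ‖u‖ ^ 4) = π / δ := by
  have hd : ∀ y ∈ Ioi δ, HasDerivAt (fun y : ℝ => δ / 2 * (y ^ 2)⁻¹ - y⁻¹)
      (1 / y ^ 2 - δ / y ^ 3) y := fun y hy => by
    have hy0 : y ≠ 0 := (hδ.trans hy).ne'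
    refine ((((hasDerivAt_id y).pow 2).inv (pow_ne_zero _ hy0)).const_mul (δ / 2)
      |>.sub ((hasDerivAt_id y).inv hy0)).congr_deriv ?_
    simp; field_simp; ring
  have hc : ContinuousWithinAt (fun y : ℝ => δ / 2 * (y ^ 2)⁻¹ - y⁻¹) (Ici δ) δ := by
    refine ContinuousAt.continuousWithinAt ?_
    have : δ ≠ 0 := hδ.ne'
    fun_prop (disch := positivity)
  have hnn : ∀ y ∈ Ioi δ, 0 ≤ 1 / y ^ 2 - δ / y ^ 3 := fun y hy => by
    have hy0 : 0 < y := hδ.trans hy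
    rw [show 1 / y ^ 2 - δ / y ^ 3 = (y - δ) / y ^ 3 by field_simp]
    exact div_nonneg (sub_nonneg.2 (le_of_lt hy)) (by positivity)
  have ht : Filter.Tendsto (fun y : ℝ => δ / 2 * (y ^ 2)⁻¹ - y⁻¹) Filter.atTop (nhds 0) := by
    have h1 := (tendsto_inv_atTop_zero (𝕜 := ℝ))
    have h2 := ((h1.pow 2).const_mul (δ / 2)).sub h1
    simpa using h2
  have key : ∀ y : ℝ, (Ioi 0).indicator (fun y : ℝ => y * max 0 (1 / y ^ 3 - δ / y ^ 4)) y =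
      (Ioi δ).indicator (fun y => 1 / y ^ 2 - δ / y ^ 3) y := fun y => by
    by_cases hy : 0 < y
    · have e : 1 / y ^ 3 - δ / y ^ 4 = (y - δ) / y ^ 4 := by field_simp
      by_cases hyd : δ < y
      · have := hnn y hyd
        have : 0 ≤ 1 / y ^ 3 - δ / y ^ 4 := by
          rw [e]; exact div_nonneg (sub_nonneg.2 hyd.le) (by positivity)
        rw [indicator_of_mem (show y ∈ Ioi 0 from hy), indicator_of_mem (show y ∈ Ioi δ from hyd),
          max_eq_right this]
        field_simp
      · have : 1 / y ^ 3 - δ / y ^ 4 ≤ 0 := by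
          rw [e]
          exact div_nonpos_of_nonpos_of_nonneg (by linarith [not_lt.1 hyd]) (by positivity)
        rw [indicator_of_mem (show y ∈ Ioi 0 from hy),
          indicator_of_notMem (show y ∉ Ioi δ from hyd), max_eq_left this, mul_zero]
    · rw [indicator_of_notMem (show y ∉ Ioi 0 from hy),
        indicator_of_notMem (show y ∉ Ioi δ from fun h => hy (hδ.trans h))]
  constructor
  · rw [integrable_fun_norm_addHaar (volume : Measure ℂ)
      (f := fun y : ℝ => max 0 (1 / y ^ 3 - δ / y ^ 4))]
    simp only [Complex.finrank_real_complex, Nat.add_one_sub_one, pow_one, smul_eq_mul]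
    rw [← integrable_indicator_iff measurableSet_Ioi, funext key,
      integrable_indicator_iff measurableSet_Ioi]
    exact integrableOn_Ioi_deriv_of_nonneg hc hd hnn ht
  · rw [integral_fun_norm_addHaar (volume : Measure ℂ)
      (f := fun y : ℝ => max 0 (1 / y ^ 3 - δ / y ^ 4))]
    simp only [Complex.finrank_real_complex, Nat.add_one_sub_one, pow_one, smul_eq_mul]
    rw [← integral_indicator measurableSet_Ioi, funext key, integral_indicator measurableSet_Ioi,
      integral_Ioi_of_hasDerivAt_of_nonneg hc hd hnn ht]
    simp [Measure.real]
    field_simp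
    norm_num

open MeasureTheory Set Real in
/-- Change of variables for an injective holomorphic map: the weight integrates over the image of an
annulus to at most its integral over the plane. -/
lemma integral_weight_comp_le {f : ℂ → ℂ} (hf : DifferentiableOn ℂ f (ball 0 1))
    (hinj : InjOn f (ball 0 1)) {δ r : ℝ} (hδ : 0 < δ) (hr1 : r < 1) :
    IntegrableOn (fun z => ‖deriv f z‖ ^ 2 * max 0 (1 / ‖f z‖ ^ 3 - δ / ‖f z‖ ^ 4))
      {z : ℂ | ‖z‖ ∈ Ioo δ r} ∧
    ∫ z in {z : ℂ | ‖z‖ ∈ Ioo δ r},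
      ‖deriv f z‖ ^ 2 * max 0 (1 / ‖f z‖ ^ 3 - δ / ‖f z‖ ^ 4) ≤ π / δ := by
  have hm : MeasurableSet {z : ℂ | ‖z‖ ∈ Ioo δ r} := measurableSet_Ioo.preimage measurable_norm
  have hsub : {z : ℂ | ‖z‖ ∈ Ioo δ r} ⊆ ball 0 1 := fun z hz => by
    simpa using hz.2.trans hr1
  have hd : ∀ z ∈ {z : ℂ | ‖z‖ ∈ Ioo δ r}, HasFDerivWithinAt f
      ((ContinuousLinearMap.toSpanSingleton ℂ (deriv f z)).restrictScalars ℝ : ℂ →L[ℝ] ℂ)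
      {z : ℂ | ‖z‖ ∈ Ioo δ r} z := fun z hz =>
    ((hf.differentiableAt (isOpen_ball.mem_nhds (hsub hz))).hasDerivAt.hasFDerivAt.restrictScalars
      ℝ).hasFDerivWithinAt
  obtain ⟨hi, he⟩ := integral_weight hδ
  have h1 := integrableOn_image_iff_integrableOn_abs_det_fderiv_smul volume hm hd
    (hinj.mono hsub) (fun u : ℂ => max 0 (1 / ‖u‖ ^ 3 - δ / ‖u‖ ^ 4))
  have h2 := integral_image_eq_integral_abs_det_fderiv_smul volume hm hd
    (hinj.mono hsub) (fun u : ℂ => max 0 (1 / ‖u‖ ^ 3 - δ / ‖u‖ ^ 4))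
  simp only [det_restrictScalars_toSpanSingleton, abs_pow, abs_norm, smul_eq_mul] at h1 h2
  refine ⟨h1.1 hi.integrableOn, ?_⟩
  rw [← h2, ← he]
  exact setIntegral_le_integral hi (Filter.Eventually.of_forall fun u => le_max_left _ _)

open MeasureTheory Set Real in
lemma area_inequality_annulus {f q n : ℂ → ℂ} (hf : DifferentiableOn ℂ f (ball 0 1))
    (hinj : InjOn f (ball 0 1)) (hq : DifferentiableOn ℂ q (ball 0 1)) (hq0 : q 0 = 1)
    (hfq : ∀ z ∈ ball (0 : ℂ) 1, z ≠ 0 → ‖deriv f z‖ ^ 2 / ‖f z‖ ^ 3 = ‖q z‖ ^ 2 / ‖z‖ ^ 3)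
    (hfn : ∀ z ∈ ball (0 : ℂ) 1, z ≠ 0 → ‖deriv f z‖ ^ 2 / ‖f z‖ ^ 4 = ‖n z‖ ^ 2 / ‖z‖ ^ 4)
    {δ r C : ℝ} (hδ : 0 < δ) (hδr : δ < r) (hr1 : r < 1) (hC : 0 ≤ C)
    (hnC : ∀ z : ℂ, ‖z‖ < r → ‖n z‖ ^ 2 ≤ 1 + C * ‖z‖ ^ 2) :
    ‖deriv q 0‖ ^ 2 * (r - δ) ≤ 1 / r - C * (Real.log δ * δ) := by
  set A := {z : ℂ | ‖z‖ ∈ Ioo δ r} with hA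
  have hm : MeasurableSet A := measurableSet_Ioo.preimage measurable_norm
  have hsub : A ⊆ ball 0 1 := fun z hz => by simpa using hz.2.trans hr1
  set β := deriv q 0 with hβ
  set b := ‖β‖ ^ 2 with hb
  set t := dslope q 0 with ht
  have htd : DifferentiableOn ℂ t (ball 0 1) :=
    (Complex.differentiableOn_dslope (ball_mem_nhds 0 one_pos)).2 hq
  have ht0 : t 0 = β := dslope_same q 0
  set ψ : ℝ → ℝ := fun y => (1 + b * y ^ 2) / y ^ 3 - δ * (1 + C * y ^ 2) / y ^ 4 with hψ
  set h₁ : ℂ → ℂ := fun z => z * t z with hh₁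
  set h₂ : ℂ → ℂ := fun z => (starRingEnd ℂ) β * (t z - β) with hh₂
  have d₁ : DifferentiableOn ℂ h₁ (ball 0 1) := differentiableOn_id.mul htd
  have d₂ : DifferentiableOn ℂ h₂ (ball 0 1) := (htd.sub_const β).const_mul _
  have c₁ : ContinuousOn (fun y : ℝ => 2 / y ^ 3) (Icc δ r) := fun y hy => by
    have : y ≠ 0 := (hδ.trans_le hy.1).ne'
    exact ContinuousAt.continuousWithinAt (by fun_prop (disch := positivity))
  have c₂ : ContinuousOn (fun y : ℝ => 2 / y) (Icc δ r) := fun y hy => by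
    have : y ≠ 0 := (hδ.trans_le hy.1).ne'
    exact ContinuousAt.continuousWithinAt (by fun_prop (disch := positivity))
  have cψ : ContinuousOn ψ (Icc δ r) := fun y hy => by
    have : y ≠ 0 := (hδ.trans_le hy.1).ne'
    exact ContinuousAt.continuousWithinAt (by fun_prop (disch := positivity))
  have i₁ := integral_annulus_re_eq_zero d₁ (by simp [hh₁]) hδ hr1 c₁
  have i₂ := integral_annulus_re_eq_zero d₂ (by simp [hh₂, ht0]) hδ hr1 c₂
  have iψ := integral_annulus_radial hδ hδr ψ
  obtain ⟨h_int, hle⟩ := integral_weight_comp_le hf hinj hδ hr1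
  have hK : IsCompact {z : ℂ | ‖z‖ ∈ Icc δ r} := by
    refine (isCompact_closedBall (0 : ℂ) r).of_isClosed_subset
      (isClosed_Icc.preimage continuous_norm) fun z hz => by simpa using hz.2
  have hAK : A ⊆ {z : ℂ | ‖z‖ ∈ Icc δ r} := fun z hz => Ioo_subset_Icc_self hz
  have hKsub : {z : ℂ | ‖z‖ ∈ Icc δ r} ⊆ ball 0 1 := fun z hz => by
    simpa using hz.2.trans_lt hr1
  have radial : ∀ φ : ℝ → ℝ, ContinuousOn φ (Icc δ r) →
      ContinuousOn (fun z : ℂ => φ ‖z‖) {z : ℂ | ‖z‖ ∈ Icc δ r} := fun φ hφ =>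
    hφ.comp continuous_norm.continuousOn fun z hz => hz
  have reC : ∀ h : ℂ → ℂ, DifferentiableOn ℂ h (ball 0 1) →
      ContinuousOn (fun z : ℂ => (h z).re) {z : ℂ | ‖z‖ ∈ Icc δ r} := fun h hh =>
    Complex.continuous_re.comp_continuousOn (hh.continuousOn.mono hKsub)
  have j₁ : IntegrableOn (fun z : ℂ => 2 / ‖z‖ ^ 3 * (h₁ z).re) A :=
    (((radial _ c₁).mul (reC h₁ d₁)).integrableOn_compact hK).mono_set hAK
  have j₂ : IntegrableOn (fun z : ℂ => 2 / ‖z‖ * (h₂ z).re) A :=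
    (((radial _ c₂).mul (reC h₂ d₂)).integrableOn_compact hK).mono_set hAK
  have jψ : IntegrableOn (fun z : ℂ => ψ ‖z‖) A :=
    ((radial _ cψ).integrableOn_compact hK).mono_set hAK
  have hpt : ∀ z ∈ A, ψ ‖z‖ + 2 / ‖z‖ ^ 3 * (h₁ z).re + 2 / ‖z‖ * (h₂ z).re ≤
      ‖deriv f z‖ ^ 2 * max 0 (1 / ‖f z‖ ^ 3 - δ / ‖f z‖ ^ 4) := fun z hz => by
    have hρ : 0 < ‖z‖ := hδ.trans hz.1
    have hz0 : z ≠ 0 := norm_pos_iff.1 hρ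
    have e1 := hfq z (hsub hz) hz0
    have e2 := hfn z (hsub hz) hz0
    have hqz : q z = 1 + z * t z := by
      have := sub_smul_dslope q 0 z
      rw [sub_zero, smul_eq_mul, hq0] at this
      rw [ht, this]; ring
    have n1 : ‖q z‖ ^ 2 = 1 + 2 * (h₁ z).re + ‖z‖ ^ 2 * ‖t z‖ ^ 2 := by
      rw [hqz, ← mul_pow, ← norm_mul, ← Complex.normSq_eq_norm_sq, ← Complex.normSq_eq_norm_sq,
        Complex.normSq_add]
      simp [hh₁]; ring
    have n2 : 2 * (h₂ z).re + b ≤ ‖t z‖ ^ 2 := by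
      have h := sq_nonneg ‖t z - β‖
      rw [← Complex.normSq_eq_norm_sq, Complex.normSq_apply] at h
      rw [hb, ← Complex.normSq_eq_norm_sq, ← Complex.normSq_eq_norm_sq, Complex.normSq_apply,
        Complex.normSq_apply]
      simp only [hh₂, Complex.mul_re, Complex.conj_re, Complex.conj_im, Complex.sub_re,
        Complex.sub_im] at h ⊢
      linarith
    calc ψ ‖z‖ + 2 / ‖z‖ ^ 3 * (h₁ z).re + 2 / ‖z‖ * (h₂ z).re
        = (1 + 2 * (h₁ z).re + ‖z‖ ^ 2 * (2 * (h₂ z).re + b)) / ‖z‖ ^ 3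
          - δ * ((1 + C * ‖z‖ ^ 2) / ‖z‖ ^ 4) := by simp only [hψ]; field_simp; ring
      _ ≤ ‖q z‖ ^ 2 / ‖z‖ ^ 3 - δ * (‖n z‖ ^ 2 / ‖z‖ ^ 4) := by
          rw [n1]
          have := hnC z hz.2
          gcongr
      _ = ‖deriv f z‖ ^ 2 * (1 / ‖f z‖ ^ 3 - δ / ‖f z‖ ^ 4) := by
          rw [← e1, ← e2]; ring
      _ ≤ _ := by gcongr; exact le_max_right _ _
  have hmono := setIntegral_mono_on ((jψ.add j₁).add j₂) h_int hm hpt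
  have hsplit : ∫ z in A, (ψ ‖z‖ + 2 / ‖z‖ ^ 3 * (h₁ z).re + 2 / ‖z‖ * (h₂ z).re) =
      2 * π * ∫ y in δ..r, y * ψ y := by
    have j₃ : IntegrableOn (fun z : ℂ => ψ ‖z‖ + 2 / ‖z‖ ^ 3 * (h₁ z).re) A := jψ.add j₁
    rw [integral_add j₃ j₂, integral_add jψ j₁, i₁, i₂, iψ, add_zero, add_zero]
  have hFTC : ∫ y in δ..r, y * ψ y =
      (-r⁻¹ + b * r + δ / 2 * (r ^ 2)⁻¹ - δ * C * Real.log r) -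
      (-δ⁻¹ + b * δ + δ / 2 * (δ ^ 2)⁻¹ - δ * C * Real.log δ) := by
    refine intervalIntegral.integral_eq_sub_of_hasDerivAt
      (f := fun y => -y⁻¹ + b * y + δ / 2 * (y ^ 2)⁻¹ - δ * C * Real.log y) (fun y hy => ?_) ?_
    · rw [uIcc_of_le hδr.le] at hy
      have hy0 : y ≠ 0 := (hδ.trans_le hy.1).ne'
      refine (((((hasDerivAt_id y).inv hy0).neg.add ((hasDerivAt_id y).const_mul b)).add
        ((((hasDerivAt_id y).pow 2).inv (pow_ne_zero _ hy0)).const_mul (δ / 2))).sub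
        ((Real.hasDerivAt_log hy0).const_mul (δ * C))).congr_deriv ?_
      simp [hψ]; field_simp; ring
    · refine ContinuousOn.intervalIntegrable ?_
      rw [uIcc_of_le hδr.le]
      exact continuousOn_id.mul cψ
  have hfin := hmono.trans hle
  change ∫ z in A, (ψ ‖z‖ + 2 / ‖z‖ ^ 3 * (h₁ z).re + 2 / ‖z‖ * (h₂ z).re) ≤ π / δ at hfin
  rw [hsplit, hFTC] at hfin
  have hr0 : 0 < r := hδ.trans hδr
  have hfin' : (-r⁻¹ + b * r + δ / 2 * (r ^ 2)⁻¹ - δ * C * Real.log r) -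
      (-δ⁻¹ + b * δ + δ / 2 * (δ ^ 2)⁻¹ - δ * C * Real.log δ) ≤ 1 / 2 * δ⁻¹ := by
    have h2 : π / δ = 2 * π * (1 / 2 * δ⁻¹) := by field_simp
    rw [h2] at hfin
    exact le_of_mul_le_mul_left hfin (by positivity)
  have e3 : δ / 2 * (δ ^ 2)⁻¹ = 1 / 2 * δ⁻¹ := by field_simp
  have e4 : 0 ≤ δ / 2 * (r ^ 2)⁻¹ := by positivity
  have e5 : δ * C * Real.log r ≤ 0 :=
    mul_nonpos_of_nonneg_of_nonpos (by positivity) (Real.log_nonpos hr0.le hr1.le)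
  rw [one_div]
  nlinarith

open Set Filter Topology in
/-- A form of the area theorem, obtained by letting the inner and outer radius of
`area_inequality_annulus` tend to `0` and `1`. -/
lemma area_inequality {f q n : ℂ → ℂ} (hf : DifferentiableOn ℂ f (ball 0 1))
    (hinj : InjOn f (ball 0 1)) (hq : DifferentiableOn ℂ q (ball 0 1)) (hq0 : q 0 = 1)
    (hn : DifferentiableOn ℂ n (ball 0 1)) (hn0 : n 0 = 1) (hn1 : deriv n 0 = 0)
    (hfq : ∀ z ∈ ball (0 : ℂ) 1, z ≠ 0 → ‖deriv f z‖ ^ 2 / ‖f z‖ ^ 3 = ‖q z‖ ^ 2 / ‖z‖ ^ 3)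
    (hfn : ∀ z ∈ ball (0 : ℂ) 1, z ≠ 0 → ‖deriv f z‖ ^ 2 / ‖f z‖ ^ 4 = ‖n z‖ ^ 2 / ‖z‖ ^ 4) :
    ‖deriv q 0‖ ≤ 1 := by
  have main : ∀ r ∈ Ioo (0 : ℝ) 1, ‖deriv q 0‖ ^ 2 * r ≤ 1 / r := fun r hr => by
    obtain ⟨C, hC, hnC⟩ : ∃ C : ℝ, 0 ≤ C ∧
        ∀ z : ℂ, ‖z‖ < r → ‖n z‖ ^ 2 ≤ 1 + C * ‖z‖ ^ 2 := by
      set l := dslope (dslope n 0) 0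
      have hl : DifferentiableOn ℂ l (ball 0 1) :=
        (Complex.differentiableOn_dslope (ball_mem_nhds 0 one_pos)).2
          ((Complex.differentiableOn_dslope (ball_mem_nhds 0 one_pos)).2 hn)
      obtain ⟨M, hM⟩ := (isCompact_closedBall (0 : ℂ) r).exists_bound_of_continuousOn
        (hl.continuousOn.mono (closedBall_subset_ball hr.2))
      have hM0 : 0 ≤ M := (norm_nonneg _).trans (hM 0 (by simpa using hr.1.le))
      refine ⟨2 * M + M ^ 2, by positivity, fun z hz => ?_⟩
      have hnz : n z = 1 + z ^ 2 * l z := by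
        have h1 := sub_smul_dslope n 0 z
        have h2 := sub_smul_dslope (dslope n 0) 0 z
        rw [dslope_same, hn1] at h2
        simp only [sub_zero, smul_eq_mul, hn0] at h1 h2
        rw [pow_two, mul_assoc, h2, h1]; ring
      have h3 : ‖n z‖ ≤ 1 + ‖z‖ ^ 2 * M := by
        rw [hnz]
        refine (norm_add_le _ _).trans ?_
        rw [norm_one, norm_mul, norm_pow]
        gcongr
        exact hM z (by simpa using hz.le)
      have hz1 : ‖z‖ ^ 2 ≤ 1 := pow_le_one₀ (norm_nonneg z) (hz.trans hr.2).le
      calc ‖n z‖ ^ 2 ≤ (1 + ‖z‖ ^ 2 * M) ^ 2 := by gcongr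
        _ = 1 + (2 * M + ‖z‖ ^ 2 * M ^ 2) * ‖z‖ ^ 2 := by ring
        _ ≤ 1 + (2 * M + 1 * M ^ 2) * ‖z‖ ^ 2 := by gcongr
        _ = _ := by ring
    have t1 : Tendsto (fun δ : ℝ => ‖deriv q 0‖ ^ 2 * (r - δ)) (𝓝[>] 0)
        (𝓝 (‖deriv q 0‖ ^ 2 * (r - 0))) :=
      (Continuous.tendsto (by fun_prop) 0).mono_left nhdsWithin_le_nhds
    have t2 : Tendsto (fun δ : ℝ => 1 / r - C * (Real.log δ * δ)) (𝓝[>] 0)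
        (𝓝 (1 / r - C * 0)) := by
      have := tendsto_log_mul_rpow_nhdsGT_zero one_pos
      simp only [Real.rpow_one] at this
      exact (this.const_mul C).const_sub _
    have h := le_of_tendsto_of_tendsto t1 t2 (by
      filter_upwards [Ioo_mem_nhdsGT hr.1] with δ hδ
      exact area_inequality_annulus hf hinj hq hq0 hfq hfn hδ.1 hδ.2 hr.2 hC hnC)
    simpa using h
  have t1 : Tendsto (fun r : ℝ => ‖deriv q 0‖ ^ 2 * r) (𝓝[<] 1) (𝓝 (‖deriv q 0‖ ^ 2 * 1)) :=
    (Continuous.tendsto (by fun_prop) 1).mono_left nhdsWithin_le_nhds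
  have t2 : Tendsto (fun r : ℝ => 1 / r) (𝓝[<] 1) (𝓝 (1 / 1)) :=
    (ContinuousAt.tendsto (f := fun r : ℝ => 1 / r) (x := 1) (by fun_prop (disch := norm_num))).mono_left
      nhdsWithin_le_nhds
  have h := le_of_tendsto_of_tendsto t1 t2 (by
    filter_upwards [Ioo_mem_nhdsLT (zero_lt_one' ℝ)] with r hr using main r hr)
  rw [mul_one, div_one] at h
  exact (sq_le_one_iff₀ (norm_nonneg _)).1 h

open Filter Topology in
lemma exists_holomorphic_sqrt {g : ℂ → ℂ} (hg : DifferentiableOn ℂ g (ball 0 1))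
    (hne : ∀ z ∈ ball (0 : ℂ) 1, g z ≠ 0) (hg0 : g 0 = 1) :
    ∃ p : ℂ → ℂ, DifferentiableOn ℂ p (ball 0 1) ∧ p 0 = 1 ∧
      ∀ z ∈ ball (0 : ℂ) 1, p z ^ 2 = g z := by
  obtain ⟨L, hL0, hL⟩ := (((hg.deriv isOpen_ball).div hg hne).isExactOn_ball).with_val_at 0 0
  have hLd : DifferentiableOn ℂ L (ball 0 1) := fun z hz =>
    (hL z hz).differentiableAt.differentiableWithinAt
  refine ⟨fun z => Complex.exp (L z / 2), (hLd.div_const 2).cexp, by simp [hL0], fun z hz => ?_⟩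
  have hder : ∀ w ∈ ball (0 : ℂ) 1, HasDerivAt (fun w => g w * Complex.exp (-L w)) 0 w :=
    fun w hw => by
      have h1 := (hg.differentiableAt (isOpen_ball.mem_nhds hw)).hasDerivAt
      refine (h1.mul (hL w hw).neg.cexp).congr_deriv ?_
      have := hne w hw
      simp only [Pi.div_apply]
      field_simp
      ring
  have hconst := isOpen_ball.is_const_of_deriv_eq_zero (convex_ball (0 : ℂ) 1).isPreconnected
    (fun w hw => (hder w hw).differentiableAt.differentiableWithinAt)
    (fun w hw => (hder w hw).deriv) hz (mem_ball_self one_pos)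
  simp only [hL0, hg0, neg_zero, Complex.exp_zero, mul_one, Complex.exp_neg] at hconst
  rw [← Complex.exp_nat_mul]
  have := Complex.exp_ne_zero (L z)
  push_cast
  rw [mul_div_cancel₀ _ two_ne_zero]
  field_simp at hconst
  exact hconst.symm

open Set Filter Topology in
/-- **Bieberbach's inequality** for the second coefficient. -/
lemma norm_deriv_deriv_zero_le {f : ℂ → ℂ} (hf : Schlicht f) : ‖deriv (deriv f) 0‖ ≤ 4 := by
  obtain ⟨hd, hinj, hf0, hf1⟩ := hf
  have h0 : (0 : ℂ) ∈ ball (0 : ℂ) 1 := mem_ball_self one_pos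
  set g := dslope f 0 with hg
  have hfg : ∀ z, f z = z * g z := fun z => by
    have := sub_smul_dslope f 0 z
    simpa [hf0] using this.symm
  have hgd : DifferentiableOn ℂ g (ball 0 1) :=
    (Complex.differentiableOn_dslope (ball_mem_nhds 0 one_pos)).2 hd
  have hg0 : g 0 = 1 := (dslope_same f 0).trans hf1
  have hgne : ∀ z ∈ ball (0 : ℂ) 1, g z ≠ 0 := fun z hz h => by
    by_cases hz0 : z = 0
    · rw [hz0, hg0] at h; exact one_ne_zero h
    · exact hz0 (hinj hz h0 (by rw [hfg z, h, mul_zero, hf0]))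
  obtain ⟨p, hpd, hp0, hpg⟩ := exists_holomorphic_sqrt hgd hgne hg0
  have hpne : ∀ z ∈ ball (0 : ℂ) 1, p z ≠ 0 := fun z hz h => hgne z hz (by simp [← hpg z hz, h])
  have hp : ∀ z ∈ ball (0 : ℂ) 1, HasDerivAt p (deriv p z) z := fun z hz =>
    (hpd.differentiableAt (isOpen_ball.mem_nhds hz)).hasDerivAt
  set s : ℂ → ℂ := fun z => p z + 2 * z * deriv p z with hs
  have hp'd : DifferentiableOn ℂ (deriv p) (ball 0 1) := hpd.deriv isOpen_ball
  have hsd : DifferentiableOn ℂ s (ball 0 1) :=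
    hpd.add ((differentiableOn_id.const_mul 2).mul hp'd)
  have hs0 : s 0 = 1 := by simp [hs, hp0]
  have hs1 : HasDerivAt s (3 * deriv p 0) 0 := by
    have h := (hp 0 h0).add (((hasDerivAt_id (0 : ℂ)).const_mul 2).mul
      (hp'd.differentiableAt (isOpen_ball.mem_nhds h0)).hasDerivAt)
    refine h.congr_deriv ?_
    simp; ring
  have hf' : ∀ z ∈ ball (0 : ℂ) 1, deriv f z = p z * s z := fun z hz => by
    have he : f =ᶠ[𝓝 z] fun w => w * p w ^ 2 := by
      filter_upwards [isOpen_ball.mem_nhds hz] with w hw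
      rw [hfg, hpg w hw]
    refine he.deriv_eq.trans (((hasDerivAt_id' z).mul ((hp z hz).pow 2)).deriv.trans ?_)
    simp [hs]; ring
  have hfn : ∀ z ∈ ball (0 : ℂ) 1, ‖f z‖ = ‖z‖ * ‖p z‖ ^ 2 := fun z hz => by
    rw [hfg, ← hpg z hz, norm_mul, norm_pow]
  have hf'' : deriv (deriv f) 0 = 4 * deriv p 0 := by
    have he : deriv f =ᶠ[𝓝 0] fun w => p w * s w := by
      filter_upwards [isOpen_ball.mem_nhds h0] with w hw using hf' w hw
    refine he.deriv_eq.trans (((hp 0 h0).mul hs1).deriv.trans ?_)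
    rw [hs0, hp0]; ring
  have hq1 : HasDerivAt (fun z => s z / p z ^ 2) (deriv p 0) 0 := by
    refine (hs1.div ((hp 0 h0).pow 2) (by simp [hp0])).congr_deriv ?_
    simp [hs0, hp0]; ring
  have hn1 : HasDerivAt (fun z => s z / p z ^ 3) 0 0 := by
    refine (hs1.div ((hp 0 h0).pow 3) (by simp [hp0])).congr_deriv ?_
    simp [hs0, hp0]
  have key := area_inequality (q := fun z => s z / p z ^ 2) (n := fun z => s z / p z ^ 3) hd hinj
    (hsd.div (hpd.pow 2) fun z hz => pow_ne_zero _ (hpne z hz)) (by simp [hs0, hp0])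
    (hsd.div (hpd.pow 3) fun z hz => pow_ne_zero _ (hpne z hz)) (by simp [hs0, hp0]) hn1.deriv
    (fun z hz hz0 => by
      have := norm_pos_iff.2 (hpne z hz)
      have := norm_pos_iff.2 hz0
      rw [hf' z hz, hfn z hz, norm_mul, norm_div, norm_pow]
      field_simp)
    (fun z hz hz0 => by
      have := norm_pos_iff.2 (hpne z hz)
      have := norm_pos_iff.2 hz0
      rw [hf' z hz, hfn z hz, norm_mul, norm_div, norm_pow]
      field_simp)
  rw [hq1.deriv] at key
  rw [hf'', norm_mul]
  norm_num
  linarith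

open Set in
lemma norm_deriv_deriv_zero_le_of_injOn {f : ℂ → ℂ} (hd : DifferentiableOn ℂ f (ball 0 1))
    (hinj : InjOn f (ball 0 1)) (h1 : deriv f 0 ≠ 0) :
    ‖deriv (deriv f) 0‖ ≤ 4 * ‖deriv f 0‖ := by
  have e : deriv (fun z => (f z - f 0) / deriv f 0) = fun z => deriv f z / deriv f 0 := by
    ext z; simp
  have h := norm_deriv_deriv_zero_le (f := fun z => (f z - f 0) / deriv f 0)
    ⟨(hd.sub_const _).div_const _, fun z hz w hw hzw => hinj hz hw (by
      have h2 := (div_left_inj' h1).1 hzw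
      exact sub_left_injective h2), by simp, by rw [e]; exact div_self h1⟩
  rw [e, deriv_div_const, norm_div, div_le_iff₀ (norm_pos_iff.2 h1)] at h
  exact h

open Set Filter Topology ComplexConjugate in
/-- Bieberbach's inequality applied to the Koebe transform of `f` at `a`. -/
lemma one_sub_sq_mul_norm_deriv_deriv_le_of_deriv_ne_zero {f : ℂ → ℂ}
    (hd : DifferentiableOn ℂ f (ball 0 1)) (hinj : InjOn f (ball 0 1)) {a : ℂ}
    (ha : a ∈ ball (0 : ℂ) 1) (h1 : deriv f a ≠ 0) :
    (1 - ‖a‖ ^ 2) * ‖deriv (deriv f) a‖ ≤ (4 + 2 * ‖a‖) * ‖deriv f a‖ := by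
  have ha1 : ‖a‖ < 1 := by simpa using ha
  have h0 : (0 : ℂ) ∈ ball (0 : ℂ) 1 := mem_ball_self one_pos
  have hpos : 0 < 1 - ‖a‖ ^ 2 := by nlinarith [norm_nonneg a]
  set k : ℂ := 1 - a * conj a with hk
  have hkr : k = ((1 - ‖a‖ ^ 2 : ℝ) : ℂ) := by
    rw [hk, Complex.mul_conj, Complex.normSq_eq_norm_sq]; push_cast; ring
  have hkn : ‖k‖ = 1 - ‖a‖ ^ 2 := by rw [hkr, Complex.norm_real, Real.norm_of_nonneg hpos.le]
  have hk0 : k ≠ 0 := by rw [← norm_pos_iff, hkn]; exact hpos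
  set φ : ℂ → ℂ := fun z => (z + a) / (1 + conj a * z) with hφ
  have hden : ∀ z ∈ ball (0 : ℂ) 1, 1 + conj a * z ≠ 0 := fun z hz h => by
    have hz1 : ‖z‖ < 1 := by simpa using hz
    have h2 : ‖conj a * z‖ = 1 := by
      rw [eq_neg_of_add_eq_zero_right h, norm_neg, norm_one]
    rw [norm_mul, RCLike.norm_conj] at h2
    nlinarith [norm_nonneg a, norm_nonneg z]
  have hmaps : MapsTo φ (ball 0 1) (ball 0 1) := fun z hz => by
    have hz1 : ‖z‖ < 1 := by simpa using hz
    have hz2 : 0 < 1 - ‖z‖ ^ 2 := by nlinarith [norm_nonneg z]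
    rw [mem_ball_zero_iff, norm_div, div_lt_one (norm_pos_iff.2 (hden z hz))]
    refine lt_of_pow_lt_pow_left₀ 2 (norm_nonneg _) ?_
    have := mul_pos hpos hz2
    simp only [← Complex.normSq_eq_norm_sq, Complex.normSq_apply, Complex.add_re, Complex.add_im,
      Complex.mul_re, Complex.mul_im, Complex.conj_re, Complex.conj_im, Complex.one_re,
      Complex.one_im] at this ⊢
    nlinarith
  have hφinj : InjOn φ (ball 0 1) := fun z hz w hw hzw => by
    have := hden z hz
    have := hden w hw
    simp only [hφ] at hzw
    rw [div_eq_div_iff ‹_› ‹_›] at hzw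
    have h3 : (z - w) * k = 0 := by rw [hk]; linear_combination hzw
    exact sub_eq_zero.1 ((mul_eq_zero.1 h3).resolve_right hk0)
  have hφd : ∀ z ∈ ball (0 : ℂ) 1, HasDerivAt φ (k / (1 + conj a * z) ^ 2) z := fun z hz => by
    have hz := hden z hz
    refine (((hasDerivAt_id' z).add_const a).div
      (((hasDerivAt_id' z).const_mul (conj a)).const_add 1) hz).congr_deriv ?_
    rw [hk]; congr 1; ring
  have hφ0 : φ 0 = a := by simp [hφ]
  have hF' : ∀ z ∈ ball (0 : ℂ) 1, HasDerivAt (f ∘ φ)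
      (deriv f (φ z) * (k / (1 + conj a * z) ^ 2)) z := fun z hz =>
    HasDerivAt.comp z (hd.differentiableAt (isOpen_ball.mem_nhds (hmaps hz))).hasDerivAt (hφd z hz)
  have hF'0 : deriv (f ∘ φ) 0 = deriv f a * k := by simp [(hF' 0 h0).deriv, hφ0]
  have hF'' : deriv (deriv (f ∘ φ)) 0 = (k * deriv (deriv f) a - 2 * conj a * deriv f a) * k := by
    have he : deriv (f ∘ φ) =ᶠ[𝓝 0] fun z => deriv f (φ z) * (k / (1 + conj a * z) ^ 2) := by
      filter_upwards [isOpen_ball.mem_nhds h0] with z hz using (hF' z hz).deriv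
    have e1 : HasDerivAt (fun z => deriv f (φ z))
        (deriv (deriv f) (φ 0) * (k / (1 + conj a * 0) ^ 2)) 0 :=
      HasDerivAt.comp (0 : ℂ) ((hd.deriv isOpen_ball).differentiableAt
        (isOpen_ball.mem_nhds (hmaps h0))).hasDerivAt (hφd 0 h0)
    have e2 := (hasDerivAt_const (0 : ℂ) k).div
      ((((hasDerivAt_id' (0 : ℂ)).const_mul (conj a)).const_add 1).pow 2)
      (pow_ne_zero 2 (hden 0 h0))
    refine he.deriv_eq.trans ((e1.mul e2).deriv.trans ?_)
    rw [hφ0]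
    simp; ring
  have h := norm_deriv_deriv_zero_le_of_injOn (f := f ∘ φ)
    (fun z hz => (hF' z hz).differentiableAt.differentiableWithinAt)
    (hinj.comp hφinj hmaps) (by rw [hF'0]; exact mul_ne_zero h1 hk0)
  rw [hF'', hF'0, norm_mul, norm_mul, ← mul_assoc] at h
  have h2 := le_of_mul_le_mul_right h (norm_pos_iff.2 hk0)
  have h3 := norm_sub_norm_le (k * deriv (deriv f) a) (2 * conj a * deriv f a)
  rw [norm_mul, norm_mul, norm_mul, hkn, RCLike.norm_conj, RCLike.norm_ofNat] at h3
  linarith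

open Set Filter Topology in
lemma one_sub_sq_mul_norm_deriv_deriv_le {f : ℂ → ℂ}
    (hd : DifferentiableOn ℂ f (ball 0 1)) (hinj : InjOn f (ball 0 1)) (h1 : deriv f 0 ≠ 0)
    {a : ℂ} (ha : a ∈ ball (0 : ℂ) 1) :
    (1 - ‖a‖ ^ 2) * ‖deriv (deriv f) a‖ ≤ (4 + 2 * ‖a‖) * ‖deriv f a‖ := by
  have hd1 := hd.deriv isOpen_ball
  have hd2 := hd1.deriv isOpen_ball
  have han : AnalyticOnNhd ℂ (deriv f) (ball 0 1) := hd1.analyticOnNhd isOpen_ball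
  have hev : ∀ᶠ z in 𝓝[≠] a, deriv f z ≠ 0 := by
    refine (han a ha).eventually_eq_zero_or_eventually_ne_zero.resolve_left fun h => h1 ?_
    exact han.eqOn_zero_of_preconnected_of_eventuallyEq_zero (convex_ball (0 : ℂ) 1).isPreconnected
      ha h (mem_ball_self one_pos)
  have c1 := (hd1.differentiableAt (isOpen_ball.mem_nhds ha)).continuousAt
  have c2 := (hd2.differentiableAt (isOpen_ball.mem_nhds ha)).continuousAt
  have t1 : Tendsto (fun z : ℂ => (1 - ‖z‖ ^ 2) * ‖deriv (deriv f) z‖) (𝓝[≠] a)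
      (𝓝 ((1 - ‖a‖ ^ 2) * ‖deriv (deriv f) a‖)) :=
    ((continuousAt_const.sub (continuous_norm.continuousAt.pow 2)).mul c2.norm).tendsto.mono_left
      nhdsWithin_le_nhds
  have t2 : Tendsto (fun z : ℂ => (4 + 2 * ‖z‖) * ‖deriv f z‖) (𝓝[≠] a)
      (𝓝 ((4 + 2 * ‖a‖) * ‖deriv f a‖)) :=
    ((continuousAt_const.add (continuousAt_const.mul continuous_norm.continuousAt)).mul
      c1.norm).tendsto.mono_left nhdsWithin_le_nhds
  refine le_of_tendsto_of_tendsto t1 t2 ?_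
  filter_upwards [hev, nhdsWithin_le_nhds (isOpen_ball.mem_nhds ha)] with z hz hzb
  exact one_sub_sq_mul_norm_deriv_deriv_le_of_deriv_ne_zero hd hinj hzb hz

open Set in
/-- **Koebe distortion theorem**, upper bound. -/
lemma Schlicht.norm_deriv_le {f : ℂ → ℂ} (hf : Schlicht f) {u : ℂ} (hu : ‖u‖ = 1) {t : ℝ}
    (ht0 : 0 ≤ t) (ht1 : t < 1) : ‖deriv f (t * u)‖ ≤ (1 + t) / (1 - t) ^ 3 := by
  obtain ⟨hd, hinj, hf0, hf1⟩ := hf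
  have hd1 := hd.deriv isOpen_ball
  have hmem : ∀ x ∈ Ico (0 : ℝ) 1, (x * u : ℂ) ∈ ball (0 : ℂ) 1 := fun x hx => by
    simpa [hu, abs_of_nonneg hx.1] using hx.2
  have hw : ∀ x ∈ Ico (0 : ℝ) 1, HasDerivAt (fun x : ℝ => ((1 - x) ^ 3 / (1 + x)) ^ 2)
      (-(2 * (4 + 2 * x) * (1 - x) ^ 5 / (1 + x) ^ 3)) x := fun x hx => by
    have : 1 + x ≠ 0 := by linarith [hx.1]
    refine (((((hasDerivAt_id' x).const_sub 1).pow 3).div ((hasDerivAt_id' x).const_add 1)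
      this).pow 2).congr_deriv ?_
    simp; field_simp; ring
  have hγ : ∀ x ∈ Ico (0 : ℝ) 1, HasDerivAt (fun x : ℝ => deriv f (x * u))
      (deriv (deriv f) (x * u) * u) x := fun x hx => by
    have h1 := (hd1.differentiableAt (isOpen_ball.mem_nhds (hmem x hx))).hasDerivAt
    have h2 : HasDerivAt (fun x : ℝ => (x * u : ℂ)) u x := by
      simpa using (Complex.ofRealCLM.hasDerivAt (x := x)).mul_const u
    exact HasDerivAt.comp x h1 h2
  have hΦ : ∀ x ∈ Ico (0 : ℝ) 1, HasDerivAt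
      (fun x : ℝ => ‖deriv f (x * u)‖ ^ 2 * ((1 - x) ^ 3 / (1 + x)) ^ 2)
      (2 * inner ℝ (deriv f (x * u)) (deriv (deriv f) (x * u) * u) * ((1 - x) ^ 3 / (1 + x)) ^ 2 +
        ‖deriv f (x * u)‖ ^ 2 * -(2 * (4 + 2 * x) * (1 - x) ^ 5 / (1 + x) ^ 3)) x := fun x hx =>
    (hγ x hx).norm_sq.mul (hw x hx)
  have hanti : AntitoneOn (fun x : ℝ => ‖deriv f (x * u)‖ ^ 2 * ((1 - x) ^ 3 / (1 + x)) ^ 2)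
      (Ico 0 1) := by
    refine antitoneOn_of_hasDerivWithinAt_nonpos (convex_Ico 0 1)
      (fun x hx => (hΦ x hx).continuousAt.continuousWithinAt)
      (fun x hx => (hΦ x (interior_subset hx)).hasDerivWithinAt) fun x hx => ?_
    have hx := interior_subset hx
    have hx1 : 0 < 1 - x := by linarith [hx.2]
    have hx2 : 0 < 1 + x := by linarith [hx.1]
    have hb := one_sub_sq_mul_norm_deriv_deriv_le hd hinj (by rw [hf1]; exact one_ne_zero)
      (hmem x hx)
    have hn : ‖(x * u : ℂ)‖ = x := by simp [hu, abs_of_nonneg hx.1]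
    rw [hn] at hb
    have hin := real_inner_le_norm (deriv f (x * u)) (deriv (deriv f) (x * u) * u)
    rw [norm_mul, hu, mul_one] at hin
    have h3 : inner ℝ (deriv f (x * u)) (deriv (deriv f) (x * u) * u) ≤
        (4 + 2 * x) / (1 - x ^ 2) * ‖deriv f (x * u)‖ ^ 2 := by
      have hp : 0 < 1 - x ^ 2 := by nlinarith
      rw [div_mul_eq_mul_div, le_div_iff₀ hp]
      nlinarith [norm_nonneg (deriv f (x * u))]
    have e : 2 * ((4 + 2 * x) / (1 - x ^ 2) * ‖deriv f (x * u)‖ ^ 2) *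
        ((1 - x) ^ 3 / (1 + x)) ^ 2 + ‖deriv f (x * u)‖ ^ 2 *
        -(2 * (4 + 2 * x) * (1 - x) ^ 5 / (1 + x) ^ 3) = 0 := by
      rw [show 1 - x ^ 2 = (1 - x) * (1 + x) by ring]
      field_simp; ring
    rw [← e]
    gcongr
  have h := hanti (left_mem_Ico.2 one_pos) ⟨ht0, ht1⟩ ht0
  have ht2 : 0 < 1 - t := by linarith
  simp only [Complex.ofReal_zero, zero_mul, hf1, norm_one, ← mul_pow] at h
  norm_num at h
  have h4 : ‖deriv f (t * u)‖ * ((1 - t) ^ 3 / (1 + t)) ≤ 1 := by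
    rwa [abs_of_nonneg (by positivity)] at h
  rw [le_div_iff₀ (by positivity)]
  rw [← mul_div_assoc, div_le_one (by positivity)] at h4
  exact h4

/-- **Koebe growth theorem.** Every schlicht function on the unit disc satisfies
`|f(z)| ≤ |z| / (1 - |z|)²`. -/
theorem schlicht_growth (f : ℂ → ℂ) (hf : Schlicht f) :
    ∀ z ∈ ball (0 : ℂ) 1, ‖f z‖ ≤ ‖z‖ / (1 - ‖z‖) ^ 2 := by
  intro z hz
  have hz1 : ‖z‖ < 1 := by simpa using hz
  by_cases hz0 : z = 0
  · simp [hz0, hf.2.2.1]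
  set u : ℂ := z / ‖z‖ with hu_def
  have hnz : (‖z‖ : ℂ) ≠ 0 := by simpa using hz0
  have hu : ‖u‖ = 1 := by simp [hu_def, hz0]
  have hzu : (‖z‖ : ℂ) * u = z := by rw [hu_def]; field_simp
  have hγ : ∀ x ∈ Set.Icc (0 : ℝ) ‖z‖, HasDerivAt (fun x : ℝ => f (x * u))
      (deriv f (x * u) * u) x := fun x hx => by
    have hm : (x * u : ℂ) ∈ ball (0 : ℂ) 1 := by
      simpa [hu, abs_of_nonneg hx.1] using hx.2.trans_lt hz1
    have h2 : HasDerivAt (fun x : ℝ => (x * u : ℂ)) u x := by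
      simpa using (Complex.ofRealCLM.hasDerivAt (x := x)).mul_const u
    exact HasDerivAt.comp x (hf.1.differentiableAt (isOpen_ball.mem_nhds hm)).hasDerivAt h2
  have hB : ∀ x ∈ Set.Icc (0 : ℝ) ‖z‖, HasDerivAt (fun x : ℝ => x / (1 - x) ^ 2)
      ((1 + x) / (1 - x) ^ 3) x := fun x hx => by
    have : 1 - x ≠ 0 := by linarith [hx.2]
    refine ((hasDerivAt_id' x).div (((hasDerivAt_id' x).const_sub 1).pow 2)
      (pow_ne_zero 2 this)).congr_deriv ?_
    simp; field_simp; ring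
  have h := image_norm_le_of_norm_deriv_right_le_deriv_boundary'
    (fun x hx => (hγ x hx).continuousAt.continuousWithinAt)
    (fun x hx => (hγ x (Set.Ico_subset_Icc_self hx)).hasDerivWithinAt)
    (by simp [hf.2.2.1])
    (fun x hx => (hB x hx).continuousAt.continuousWithinAt)
    (fun x hx => (hB x (Set.Ico_subset_Icc_self hx)).hasDerivWithinAt)
    (fun x hx => by
      rw [norm_mul, hu, mul_one]
      exact hf.norm_deriv_le hu hx.1 (hx.2.trans hz1))
    (Set.right_mem_Icc.2 (norm_nonneg z))
  simpa only [hzu] using h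
end

section
/- Let Ω be a domain (nonempty connected open set) in ℂⁿ, and let {f_j} be a sequence of holomorphic functions on Ω. Assume that the f_j converge pointwise on Ω to a limit function f. Then there exists a dense open subset V of Ω such that f is holomorphic on V and the convergence f_j → f is uniform on every compact subset of V. -/
open Filter Topology

open Metric Set

/-- An equicontinuous family converging pointwise converges locally uniformly. -/
theorem EquicontinuousOn.tendstoLocallyUniformlyOn {ι X Y : Type*} [TopologicalSpace X]
    [PseudoMetricSpace Y] {l : Filter ι} [l.NeBot] {f : ι → X → Y} {F : X → Y} {s : Set X}
    (hf : EquicontinuousOn f s) (h : ∀ x ∈ s, Tendsto (f · x) l (𝓝 (F x))) :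
    TendstoLocallyUniformlyOn f F l s := by
  rw [Metric.tendstoLocallyUniformlyOn_iff]
  intro ε hε x hx
  have hequi := hf x hx _ (dist_mem_uniformity (show 0 < ε / 4 by positivity))
  refine ⟨_, inter_mem hequi self_mem_nhdsWithin, ?_⟩
  filter_upwards [Metric.tendsto_nhds.1 (h x hx) (ε / 4) (by positivity)] with i hi y ⟨hy, hys⟩
  have hF : dist (F x) (F y) ≤ ε / 4 :=
    le_of_tendsto ((h x hx).dist (h y hys)) (Eventually.of_forall fun j => (hy j).le)
  have hy' : dist (f i x) (f i y) < ε / 4 := hy i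
  have h₁ := dist_triangle4 (F y) (F x) (f i x) (f i y)
  rw [dist_comm (F y) (F x), dist_comm (F x) (f i x)] at h₁
  linarith

/-- A locally uniformly bounded family of holomorphic functions is equicontinuous. -/
theorem Complex.equicontinuousAt_of_eventually_norm_le {ι E G : Type*}
    [NormedAddCommGroup E] [NormedSpace ℂ E] [NormedAddCommGroup G] [NormedSpace ℂ G]
    {f : ι → E → G} {U : Set E} {x : E} {M : ℝ} (hU : U ∈ 𝓝 x)
    (hf : ∀ i, DifferentiableOn ℂ (f i) U) (hM : ∀ᶠ y in 𝓝 x, ∀ i, ‖f i y‖ ≤ M) :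
    EquicontinuousAt f x := by
  obtain ⟨r, hr, hball⟩ := Metric.mem_nhds_iff.1 (inter_mem hU hM)
  refine Metric.equicontinuousAt_of_continuity_modulus (fun y => 2 * M / r * dist y x) ?_ f ?_
  · have : Continuous fun y => 2 * M / r * dist y x := by fun_prop
    simpa using this.tendsto x
  · filter_upwards [ball_mem_nhds x hr] with y hy i
    rw [dist_comm]
    refine dist_le_div_mul_dist_of_mapsTo_ball
      ((hf i).mono fun z hz => (hball hz).1) (fun z hz => ?_) hy
    rw [mem_closedBall, dist_eq_norm]
    have hz := (hball hz).2 i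
    have hx := (hball (mem_ball_self hr)).2 i
    linarith [norm_sub_le (f i z) (f i x)]

/-- If holomorphic functions form a uniformly Cauchy family on a thickening of `s`, then so do
their derivatives on `s`. -/
theorem UniformCauchySeqOn.fderiv_of_thickening {ι E G : Type*}
    [NormedAddCommGroup E] [NormedSpace ℂ E] [NormedAddCommGroup G] [NormedSpace ℂ G]
    {l : Filter ι} {f : ι → E → G} {s : Set E} {r : ℝ} (hr : 0 < r)
    (hf : ∀ i, DifferentiableOn ℂ (f i) (thickening r s))
    (h : UniformCauchySeqOn f l (thickening r s)) :
    UniformCauchySeqOn (fun i => fderiv ℂ (f i)) l s := by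
  intro u hu
  obtain ⟨ε, hε, hεu⟩ := Metric.mem_uniformity_dist.1 hu
  filter_upwards [h _ (dist_mem_uniformity (show 0 < ε * r / 4 by positivity))] with p hp x hx
  apply hεu
  have hsub : ball x r ⊆ thickening r s := ball_subset_thickening hx r
  have hd (i : ι) : DifferentiableOn ℂ (f i) (ball x r) := (hf i).mono hsub
  have hda (i : ι) : DifferentiableAt ℂ (f i) x := (hd i).differentiableAt (ball_mem_nhds x hr)
  rw [dist_eq_norm, ← fderiv_sub (hda _) (hda _)]
  have hle : ‖fderiv ℂ (f p.1 - f p.2) x‖ ≤ (ε * r / 2) / r := by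
    refine Complex.norm_fderiv_le_div_of_mapsTo_ball ((hd _).sub (hd _)) (fun z hz => ?_) hr
    have hz : dist (f p.1 z) (f p.2 z) < ε * r / 4 := hp z (hsub hz)
    have hx : dist (f p.1 x) (f p.2 x) < ε * r / 4 := hp x (hsub (mem_ball_self hr))
    rw [dist_eq_norm] at hz hx
    rw [mem_closedBall, dist_eq_norm]
    simp only [Pi.sub_apply]
    linarith [norm_sub_le (f p.1 z - f p.2 z) (f p.1 x - f p.2 x)]
  calc _ ≤ _ := hle
    _ = ε / 2 := by field_simp
    _ < ε := half_lt_self hε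

/-- A locally uniform limit of holomorphic functions of several variables is holomorphic. -/
theorem TendstoLocallyUniformlyOn.differentiableOn_of_properSpace {ι E G : Type*}
    [NormedAddCommGroup E] [NormedSpace ℂ E] [ProperSpace E]
    [NormedAddCommGroup G] [NormedSpace ℂ G] [CompleteSpace G]
    {l : Filter ι} [l.NeBot] {f : ι → E → G} {F : E → G} {U : Set E} (hU : IsOpen U)
    (hf : ∀ i, DifferentiableOn ℂ (f i) U) (h : TendstoLocallyUniformlyOn f F l U) :
    DifferentiableOn ℂ F U := by
  intro x hx
  obtain ⟨r, hr, hrU⟩ := Metric.nhds_basis_closedBall.mem_iff.1 (hU.mem_nhds hx)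
  have hunif : TendstoUniformlyOn f F l (closedBall x r) :=
    (tendstoLocallyUniformlyOn_iff_tendstoUniformlyOn_of_compact (isCompact_closedBall x r)).1
      (h.mono hrU)
  have hthick : thickening (r / 2) (ball x (r / 2)) ⊆ closedBall x r := by
    rw [thickening_ball (half_pos hr) (half_pos hr), add_halves]
    exact ball_subset_closedBall
  have hcauchy : UniformCauchySeqOn (fun i => fderiv ℂ (f i)) l (ball x (r / 2)) :=
    (hunif.mono hthick).uniformCauchySeqOn.fderiv_of_thickening (half_pos hr)
      fun i => (hf i).mono (hthick.trans hrU)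
  have hlim : ∀ y ∈ ball x (r / 2), ∃ A, Tendsto (fun i => fderiv ℂ (f i) y) l (𝓝 A) :=
    fun y hy => CompleteSpace.complete (hcauchy.cauchy_map hy)
  choose! g hg using hlim
  have hsub : ball x (r / 2) ⊆ U := (self_subset_thickening (half_pos hr) _).trans
    (hthick.trans hrU)
  exact (hasFDerivAt_of_tendstoUniformlyOn isOpen_ball
    (hcauchy.tendstoUniformlyOn_of_tendsto hg)
    (fun i y hy => ((hf i).differentiableAt (hU.mem_nhds (hsub hy))).hasFDerivAt)
    (fun y hy => h.tendsto_at (hsub hy))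
    (mem_ball_self (half_pos hr))).differentiableAt.differentiableWithinAt

/-- In a Baire space, a pointwise bounded family of continuous functions on an open set is locally
uniformly bounded on a dense subset. -/
theorem subset_closure_eventually_norm_le {ι X G : Type*} [TopologicalSpace X] [RegularSpace X]
    [BaireSpace X] [SeminormedAddCommGroup G] {f : ι → X → G} {U : Set X} (hU : IsOpen U)
    (hf : ∀ i, ContinuousOn (f i) U) (h : ∀ x ∈ U, ∃ M : ℝ, ∀ i, ‖f i x‖ ≤ M) :
    U ⊆ closure {x ∈ U | ∃ M : ℝ, ∀ᶠ y in 𝓝 x, ∀ i, ‖f i y‖ ≤ M} := by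
  intro x hx
  rw [mem_closure_iff_nhds]
  intro t ht
  obtain ⟨C, ⟨hCx, hC⟩, hCsub⟩ :=
    (closed_nhds_basis x).mem_iff.1 (inter_mem ht (hU.mem_nhds hx))
  let A : ℕ → Set X := fun n => (⋂ i, C ∩ f i ⁻¹' closedBall 0 n) ∪ (interior C)ᶜ
  have hA (n : ℕ) : IsClosed (A n) := by
    refine (isClosed_iInter fun i => ?_).union isOpen_interior.isClosed_compl
    exact ((hf i).mono (hCsub.trans inter_subset_right)).preimage_isClosed_of_isClosed hC
      isClosed_closedBall
  have hcover : ⋃ n, A n = univ := by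
    refine eq_univ_of_forall fun y => mem_iUnion.2 ?_
    by_cases hy : y ∈ interior C
    · obtain ⟨M, hM⟩ := h y (hCsub (interior_subset hy)).2
      obtain ⟨n, hn⟩ := exists_nat_ge M
      refine ⟨n, Or.inl (mem_iInter.2 fun i => ⟨interior_subset hy, ?_⟩)⟩
      simpa using (hM i).trans hn
    · exact ⟨0, Or.inr hy⟩
  obtain ⟨y, hyC, hy⟩ := (dense_iUnion_interior_of_closed hA hcover).inter_open_nonempty
    (interior C) isOpen_interior ⟨x, mem_interior_iff_mem_nhds.2 hCx⟩
  obtain ⟨n, hn⟩ := mem_iUnion.1 hy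
  refine ⟨y, (hCsub (interior_subset hyC)).1, (hCsub (interior_subset hyC)).2, n, ?_⟩
  filter_upwards [isOpen_interior.mem_nhds hn, isOpen_interior.mem_nhds hyC] with z hz hzC i
  have hzA := (interior_subset hz).resolve_right (not_not_intro hzC)
  simpa using (mem_iInter.1 hzA i).2

/-- **Osgood's theorem in several complex variables.** If a sequence of holomorphic
functions on a domain in ℂⁿ converges pointwise, then the limit is holomorphic on a
dense open subset, and the convergence is uniform on compact subsets of that set. -/
theorem osgood_pointwise_limit_holomorphic_several_variables
    (n : ℕ) (Ω : Set (Fin n → ℂ)) (hΩopen : IsOpen Ω) (hΩconn : IsConnected Ω)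
    (f : ℕ → (Fin n → ℂ) → ℂ) (F : (Fin n → ℂ) → ℂ)
    (hf : ∀ j, DifferentiableOn ℂ (f j) Ω)
    (hconv : ∀ z ∈ Ω, Tendsto (fun j => f j z) atTop (𝓝 (F z))) :
    ∃ V : Set (Fin n → ℂ), IsOpen V ∧ V ⊆ Ω ∧ Ω ⊆ closure V ∧
      DifferentiableOn ℂ F V ∧
      ∀ K ⊆ V, IsCompact K → TendstoUniformlyOn f F atTop K := by
  have hbdd : ∀ z ∈ Ω, ∃ M : ℝ, ∀ j, ‖f j z‖ ≤ M := fun z hz => by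
    obtain ⟨M, hM⟩ := (hconv z hz).norm.bddAbove_range
    exact ⟨M, fun j => hM (mem_range_self j)⟩
  set V : Set (Fin n → ℂ) := {z ∈ Ω | ∃ M : ℝ, ∀ᶠ y in 𝓝 z, ∀ j, ‖f j y‖ ≤ M}
  have hVΩ : V ⊆ Ω := fun z hz => hz.1
  have hVopen : IsOpen V := by
    rw [isOpen_iff_mem_nhds]
    rintro z ⟨hz, M, hM⟩
    filter_upwards [hΩopen.mem_nhds hz, eventually_eventually_nhds.2 hM] with y hy hMy
    exact ⟨hy, M, hMy⟩
  have hequi : EquicontinuousOn f V := by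
    rintro z ⟨hz, M, hM⟩
    exact (Complex.equicontinuousAt_of_eventually_norm_le (hΩopen.mem_nhds hz) hf
      hM).equicontinuousWithinAt V
  have hunif : TendstoLocallyUniformlyOn f F atTop V :=
    hequi.tendstoLocallyUniformlyOn fun z hz => hconv z (hVΩ hz)
  exact ⟨V, hVopen, hVΩ,
    subset_closure_eventually_norm_le hΩopen (fun j => (hf j).continuousOn) hbdd,
    hunif.differentiableOn_of_properSpace hVopen fun j => (hf j).mono hVΩ,
    fun K hKV hK => (tendstoLocallyUniformlyOn_iff_tendstoUniformlyOn_of_compact hK).1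
      (hunif.mono hKV)⟩
end

section
/- Let Ω be a domain (nonempty connected open set) in ℂⁿ, and let {f_j} be a sequence of holomorphic functions on Ω converging pointwise on Ω to a limit function f. Let ℓ be any complex line in ℂⁿ, i.e., ℓ = {a + ζ·b : ζ ∈ ℂ} for some a, b ∈ ℂⁿ with b ≠ 0. Then the restriction of f to ℓ ∩ Ω is holomorphic (as a function of the line parameter ζ) on a subset of ℓ ∩ Ω that is open and dense in the relative topology of ℓ ∩ Ω. -/
open Filter Topology

open Metric MeasureTheory in
/-- A bounded pointwise limit of holomorphic functions on a closed disc is holomorphic on the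
open disc: pass to the limit in the Cauchy integral formula. -/
theorem differentiableOn_ball_of_tendsto_of_norm_le_s10 {g : ℕ → ℂ → ℂ} {G : ℂ → ℂ} {c : ℂ} {R M : ℝ}
    (hR : 0 < R) (hg : ∀ j, DiffContOnCl ℂ (g j) (ball c R))
    (hM : ∀ j, ∀ z ∈ closedBall c R, ‖g j z‖ ≤ M)
    (hlim : ∀ z ∈ closedBall c R, Tendsto (fun j => g j z) atTop (𝓝 (G z))) :
    DifferentiableOn ℂ G (ball c R) := by
  lift R to NNReal using hR.le
  have hmem (θ : ℝ) : circleMap c R θ ∈ closedBall c R := circleMap_mem_closedBall c hR.le θ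
  have hcont (j : ℕ) : Continuous fun θ => g j (circleMap c R θ) :=
    (hg j).continuousOn_ball.comp_continuous (continuous_circleMap c R) hmem
  have hGint : CircleIntegrable G c R := by
    have hmeas : AEStronglyMeasurable (fun θ => G (circleMap c R θ)) volume :=
      aestronglyMeasurable_of_tendsto_ae atTop (fun j => (hcont j).aestronglyMeasurable)
        (ae_of_all _ fun θ => hlim _ (hmem θ))
    refine (intervalIntegrable_const (c := M)).mono_fun' hmeas.restrict (ae_of_all _ fun θ => ?_)
    exact le_of_tendsto (hlim _ (hmem θ)).norm (Eventually.of_forall fun j => hM j _ (hmem θ))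
  have hcauchy := (hasFPowerSeriesOn_cauchy_integral hGint (NNReal.coe_pos.1 hR)).differentiableOn
  rw [Metric.eball_coe] at hcauchy
  refine hcauchy.congr fun w hw => ?_
  have hne (θ : ℝ) : circleMap c R θ - w ≠ 0 :=
    sub_ne_zero.2 (circleMap_ne_mem_ball hw θ)
  have hker : Continuous fun θ : ℝ => deriv (circleMap c R) θ * (circleMap c R θ - w)⁻¹ := by
    simp only [deriv_circleMap]
    exact ((continuous_circleMap 0 R).mul continuous_const).mul
      (((continuous_circleMap c R).sub continuous_const).inv₀ hne)
  have hint : Tendsto (fun j => ∮ z in C(c, R), (z - w)⁻¹ • g j z) atTop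
      (𝓝 (∮ z in C(c, R), (z - w)⁻¹ • G z)) := by
    simp only [circleIntegral, smul_eq_mul, ← mul_assoc]
    refine intervalIntegral.tendsto_integral_filter_of_dominated_convergence
      (fun θ => ‖deriv (circleMap c R) θ * (circleMap c R θ - w)⁻¹‖ * M)
      (Eventually.of_forall fun j => (hker.mul (hcont j)).aestronglyMeasurable)
      (Eventually.of_forall fun j => ae_of_all _ fun θ _ => ?_)
      ((hker.norm.mul continuous_const).intervalIntegrable _ _)
      (ae_of_all _ fun θ _ => (hlim _ (hmem θ)).const_mul _)
    rw [norm_mul]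
    exact mul_le_mul_of_nonneg_left (hM j _ (hmem θ)) (norm_nonneg _)
  refine tendsto_nhds_unique (hlim w (ball_subset_closedBall hw)) ?_
  refine (hint.const_smul (2 * Real.pi * Complex.I : ℂ)⁻¹).congr fun j => ?_
  rw [(hg j).circleIntegral_sub_inv_smul hw, inv_smul_smul₀ Complex.two_pi_I_ne_zero]

/-- A pointwise bounded sequence of continuous functions on a nonempty open set in a Baire space
is uniformly bounded on some nonempty open subset. -/
theorem exists_isOpen_subset_forall_norm_le {X E : Type*} [TopologicalSpace X] [BaireSpace X]
    [SeminormedAddCommGroup E] {W : Set X} (hW : IsOpen W) (hne : W.Nonempty) {g : ℕ → X → E}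
    (hg : ∀ j, ContinuousOn (g j) W) (hbdd : ∀ x ∈ W, ∃ M : ℝ, ∀ j, ‖g j x‖ ≤ M) :
    ∃ U ⊆ W, IsOpen U ∧ U.Nonempty ∧ ∃ M : ℝ, ∀ j, ∀ x ∈ U, ‖g j x‖ ≤ M := by
  have := hW.baireSpace
  have := hne.to_subtype
  obtain ⟨m, hm⟩ := nonempty_interior_of_iUnion_of_closed
    (f := fun m : ℕ => {x : W | ∀ j, ‖g j x‖ ≤ m})
    (fun m => by
      simp only [Set.ofPred_forall]
      exact isClosed_iInter fun j =>
        isClosed_le (continuousOn_iff_continuous_domRestrict.1 (hg j)).norm continuous_const)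
    (Set.eq_univ_of_forall fun x => by
      obtain ⟨M, hM⟩ := hbdd x x.2
      obtain ⟨m, hm⟩ := exists_nat_ge M
      exact Set.mem_iUnion.2 ⟨m, fun j => (hM j).trans hm⟩)
  refine ⟨(↑) '' interior {x : W | ∀ j, ‖g j x‖ ≤ m}, Subtype.coe_image_subset _ _,
    hW.isOpenMap_subtype_val _ isOpen_interior, hm.image _, m, ?_⟩
  rintro j _ ⟨x, hx, rfl⟩
  exact interior_subset hx j

open Metric in
/-- **Osgood's theorem**: a pointwise limit of holomorphic functions on an open subset of `ℂ` is
holomorphic on a dense open subset. -/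
theorem exists_dense_isOpen_differentiableOn_of_tendsto {P : Set ℂ} (hP : IsOpen P)
    {g : ℕ → ℂ → ℂ} {G : ℂ → ℂ} (hg : ∀ j, DifferentiableOn ℂ (g j) P)
    (hlim : ∀ z ∈ P, Tendsto (fun j => g j z) atTop (𝓝 (G z))) :
    ∃ V : Set ℂ, IsOpen V ∧ V ⊆ P ∧ P ⊆ closure V ∧ DifferentiableOn ℂ G V := by
  refine ⟨interior {z ∈ P | DifferentiableAt ℂ G z}, isOpen_interior,
    interior_subset.trans (Set.sep_subset _ _), fun z hz => mem_closure_iff.2 fun O hO hzO => ?_,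
    fun z hz => (interior_subset hz).2.differentiableWithinAt⟩
  obtain ⟨U, hUW, hU, ⟨c, hc⟩, M, hM⟩ := exists_isOpen_subset_forall_norm_le (hO.inter hP)
    ⟨z, hzO, hz⟩ (fun j => (hg j).continuousOn.mono Set.inter_subset_right) fun x hx => by
      obtain ⟨M, hM⟩ := (hlim x hx.2).norm.bddAbove_range
      exact ⟨M, fun j => hM ⟨j, rfl⟩⟩
  obtain ⟨R, hR, hRU⟩ := nhds_basis_closedBall.mem_iff.1 (hU.mem_nhds hc)
  have hRP : closedBall c R ⊆ P := fun x hx => (hUW (hRU hx)).2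
  have hd : DifferentiableOn ℂ G (ball c R) :=
    differentiableOn_ball_of_tendsto_of_norm_le_s10 hR
      (fun j => ((hg j).mono hRP).diffContOnCl_ball subset_rfl)
      (fun j x hx => hM j x (hRU hx)) fun x hx => hlim x (hRP hx)
  refine ⟨c, (hUW hc).1, mem_interior.2 ⟨ball c R, fun x hx => ?_, isOpen_ball, mem_ball_self hR⟩⟩
  exact ⟨hRP (ball_subset_closedBall hx), hd.differentiableAt (isOpen_ball.mem_nhds hx)⟩

/-- If a sequence of holomorphic functions on a domain `Ω ⊆ ℂⁿ` converges pointwise to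
`f`, then for every complex line `ℓ = {a + ζ·b : ζ ∈ ℂ}` (with `b ≠ 0`), the restriction
of `f` to `ℓ ∩ Ω` is holomorphic, in the line parameter, on a relatively dense open
subset of `ℓ ∩ Ω`.  Via the parametrization `ζ ↦ a + ζ·b`, the set `ℓ ∩ Ω` corresponds
to the open set `P = {ζ : ℂ | a + ζ·b ∈ Ω}`. -/
theorem pointwise_limit_holomorphic_on_lines
    (n : ℕ) (Ω : Set (Fin n → ℂ)) (hΩopen : IsOpen Ω) (hΩconn : IsConnected Ω)
    (f : ℕ → (Fin n → ℂ) → ℂ) (F : (Fin n → ℂ) → ℂ)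
    (hf : ∀ j, DifferentiableOn ℂ (f j) Ω)
    (hconv : ∀ z ∈ Ω, Tendsto (fun j => f j z) atTop (𝓝 (F z)))
    (a b : Fin n → ℂ) (hb : b ≠ 0) :
    ∃ V : Set ℂ, IsOpen V ∧ V ⊆ {ζ : ℂ | a + ζ • b ∈ Ω} ∧
      {ζ : ℂ | a + ζ • b ∈ Ω} ⊆ closure V ∧
      DifferentiableOn ℂ (fun ζ : ℂ => F (a + ζ • b)) V := by
  have hline : Differentiable ℂ fun ζ : ℂ => a + ζ • b := by fun_prop
  exact exists_dense_isOpen_differentiableOn_of_tendsto (hΩopen.preimage hline.continuous)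
    (fun j => (hf j).comp hline.differentiableOn fun _ hζ => hζ) fun ζ hζ => hconv _ hζ
end

section
/- Let Ω be a domain (nonempty connected open set) in ℂⁿ with n ≥ 2, and let {f_j} be a sequence of holomorphic functions on Ω. Suppose there is a function f on Ω such that for every analytic disc φ : D → Ω that extends continuously to the closed disc with φ(closure of D) ⊆ Ω, the sequence {f_j ∘ φ} converges uniformly on the closed disc to f ∘ φ. Then f is holomorphic on Ω. -/
open Filter Topology Metric

open scoped BoundedContinuousFunction

/-- A Cauchy estimate: a uniformly Cauchy sequence of holomorphic functions on a ball has
uniformly Cauchy derivatives on the concentric ball of half the radius. -/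
theorem UniformCauchySeqOn.fderiv_ball {E G : Type*} [NormedAddCommGroup E] [NormedSpace ℂ E]
    [NormedAddCommGroup G] [NormedSpace ℂ G] {f : ℕ → E → G} {x : E} {r : ℝ} (hr : 0 < r)
    (hf : ∀ j, DifferentiableOn ℂ (f j) (ball x r))
    (hc : UniformCauchySeqOn f atTop (ball x r)) :
    UniformCauchySeqOn (fun j => fderiv ℂ (f j)) atTop (ball x (r / 2)) := by
  rw [Metric.uniformCauchySeqOn_iff] at hc ⊢
  intro ε hε
  obtain ⟨N, hN⟩ := hc (ε * r / 8) (by positivity)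
  refine ⟨N, fun m hm k hk z hz => ?_⟩
  have hsub : ball z (r / 2) ⊆ ball x r := by
    intro w hw
    rw [mem_ball] at hw hz ⊢
    linarith [dist_triangle w z x]
  have hzr : z ∈ ball x r := hsub (mem_ball_self (by positivity))
  have hdiff : DifferentiableOn ℂ (f m - f k) (ball z (r / 2)) :=
    ((hf m).sub (hf k)).mono hsub
  have hmaps : Set.MapsTo (f m - f k) (ball z (r / 2))
      (closedBall ((f m - f k) z) (ε * r / 4)) := by
    intro w hw
    have h₁ := hN m hm k hk w (hsub hw)
    have h₂ := hN m hm k hk z hzr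
    rw [dist_eq_norm] at h₁ h₂
    rw [mem_closedBall, dist_eq_norm]
    have := norm_sub_le (f m w - f k w) (f m z - f k z)
    simp only [Pi.sub_apply]
    linarith
  have hle := Complex.norm_fderiv_le_div_of_mapsTo_ball hdiff hmaps (by positivity)
  have hat : ∀ j, DifferentiableAt ℂ (f j) z := fun j =>
    (hf j).differentiableAt (isOpen_ball.mem_nhds hzr)
  rw [fderiv_sub (hat m) (hat k)] at hle
  rw [dist_eq_norm]
  have : ε * r / 4 / (r / 2) = ε / 2 := by field_simp; norm_num
  linarith

/-- A locally uniform limit of holomorphic functions on an open subset of a locally compact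
complex normed space is holomorphic. -/
theorem TendstoLocallyUniformlyOn.differentiableOn_complex {E G : Type*}
    [NormedAddCommGroup E] [NormedSpace ℂ E] [ProperSpace E]
    [NormedAddCommGroup G] [NormedSpace ℂ G] [CompleteSpace G]
    {f : ℕ → E → G} {F : E → G} {Ω : Set E} (hΩ : IsOpen Ω)
    (hf : ∀ j, DifferentiableOn ℂ (f j) Ω) (h : TendstoLocallyUniformlyOn f F atTop Ω) :
    DifferentiableOn ℂ F Ω := by
  intro x hx
  obtain ⟨r, hr, hrΩ⟩ := Metric.nhds_basis_closedBall.mem_iff.1 (hΩ.mem_nhds hx)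
  have hball : ball x r ⊆ Ω := ball_subset_closedBall.trans hrΩ
  have hunif : TendstoUniformlyOn f F atTop (closedBall x r) :=
    (tendstoLocallyUniformlyOn_iff_forall_isCompact hΩ).1 h _ hrΩ (isCompact_closedBall x r)
  have hder := UniformCauchySeqOn.fderiv_ball hr (fun j => (hf j).mono hball)
    (hunif.uniformCauchySeqOn.mono ball_subset_closedBall)
  have hsub : ball x (r / 2) ⊆ ball x r := ball_subset_ball (by linarith)
  have hlim : ∀ z ∈ ball x (r / 2), ∃ L, Tendsto (fun j => fderiv ℂ (f j) z) atTop (𝓝 L) :=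
    fun z hz => cauchySeq_tendsto_of_complete (hder.cauchySeq hz)
  choose! g hg using hlim
  have hF := hasFDerivAt_of_tendstoUniformlyOn isOpen_ball
    (hder.tendstoUniformlyOn_of_tendsto hg)
    (fun j z hz => ((hf j).differentiableAt
      (hΩ.mem_nhds (hball (hsub hz)))).hasFDerivAt)
    (fun z hz => hunif.tendsto_at (ball_subset_closedBall (hsub hz)))
    (mem_ball_self (half_pos hr))
  exact hF.differentiableAt.differentiableWithinAt

/-- A retraction of `ℂ` onto the closed unit disc. -/
noncomputable def discRetraction (ζ : ℂ) : ℂ := ((max 1 ‖ζ‖ : ℝ) : ℂ)⁻¹ * ζ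

theorem continuous_discRetraction : Continuous discRetraction := by
  unfold discRetraction
  refine Continuous.mul (Continuous.inv₀ (by fun_prop) fun ζ => ?_) continuous_id
  exact_mod_cast (lt_of_lt_of_le one_pos (le_max_left 1 ‖ζ‖)).ne'

theorem norm_discRetraction_le (ζ : ℂ) : ‖discRetraction ζ‖ ≤ 1 := by
  have h : 0 < max 1 ‖ζ‖ := lt_of_lt_of_le one_pos (le_max_left 1 ‖ζ‖)
  rw [discRetraction, norm_mul, norm_inv, Complex.norm_real, Real.norm_of_nonneg h.le,
    inv_mul_le_iff₀ h, mul_one]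
  exact le_max_right _ _

theorem discRetraction_of_norm_le {ζ : ℂ} (h : ‖ζ‖ ≤ 1) : discRetraction ζ = ζ := by
  simp [discRetraction, max_eq_left h]

/-- A holomorphic function on the unit disc with value `1` at `a` and `0` at `1`, bounded
independently of `a ∈ (0, 1)`. -/
noncomputable def discPeak (a : ℝ) (ζ : ℂ) : ℂ := (1 + a) * (1 - ζ) / (1 - a * ζ)

theorem discPeak_self {a : ℝ} (h₀ : 0 < a) (h₁ : a < 1) : discPeak a a = 1 := by
  have h : (1 - a * a : ℂ) ≠ 0 := by
    have : (1 - a * a : ℝ) ≠ 0 := by nlinarith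
    exact_mod_cast this
  rw [discPeak, div_eq_one_iff_eq h]
  ring

theorem discPeak_one (a : ℝ) : discPeak a 1 = 0 := by simp [discPeak]

theorem one_sub_le_norm_one_sub_mul {a : ℝ} (h₀ : 0 < a) {ζ : ℂ} (hζ : ‖ζ‖ ≤ 1) :
    1 - a ≤ ‖1 - a * ζ‖ := by
  have h := norm_sub_norm_le (1 : ℂ) (a * ζ)
  rw [norm_one, norm_mul, Complex.norm_real, Real.norm_of_nonneg h₀.le] at h
  nlinarith

theorem one_sub_mul_ne_zero {a : ℝ} (h₀ : 0 < a) (h₁ : a < 1) {ζ : ℂ} (hζ : ‖ζ‖ ≤ 1) :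
    1 - a * ζ ≠ 0 :=
  norm_pos_iff.1 (lt_of_lt_of_le (sub_pos.2 h₁) (one_sub_le_norm_one_sub_mul h₀ hζ))

theorem norm_discPeak_le {a : ℝ} (h₀ : 0 < a) (h₁ : a < 1) {ζ : ℂ} (hζ : ‖ζ‖ ≤ 1) :
    ‖discPeak a ζ‖ ≤ 4 := by
  have hle := one_sub_le_norm_one_sub_mul h₀ hζ
  have hnum : ‖1 - ζ‖ ≤ 2 * ‖1 - a * ζ‖ := by
    have h : (1 - ζ : ℂ) = (1 - a * ζ) - ((1 - a : ℝ) : ℂ) * ζ := by push_cast; ring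
    have h' := norm_sub_le (1 - a * ζ) (((1 - a : ℝ) : ℂ) * ζ)
    rw [← h, norm_mul, Complex.norm_real, Real.norm_of_nonneg (sub_pos.2 h₁).le] at h'
    nlinarith
  have hcoef : ‖(1 + a : ℂ)‖ ≤ 2 := by
    have h : (1 + a : ℂ) = ((1 + a : ℝ) : ℂ) := by push_cast; rfl
    rw [h, Complex.norm_real, Real.norm_of_nonneg (by linarith)]
    linarith
  rw [discPeak, norm_div, norm_mul, div_le_iff₀ (by linarith)]
  nlinarith [norm_nonneg (1 - ζ)]

theorem continuousOn_discPeak {a : ℝ} (h₀ : 0 < a) (h₁ : a < 1) :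
    ContinuousOn (discPeak a) {ζ | ‖ζ‖ ≤ 1} :=
  ContinuousOn.div (by fun_prop) (by fun_prop) fun _ hζ => one_sub_mul_ne_zero h₀ h₁ hζ

theorem differentiableOn_discPeak {a : ℝ} (h₀ : 0 < a) (h₁ : a < 1) :
    DifferentiableOn ℂ (discPeak a) (ball 0 1) :=
  DifferentiableOn.div (by fun_prop) (by fun_prop) fun _ hζ =>
    one_sub_mul_ne_zero h₀ h₁ (mem_ball_zero_iff.1 hζ).le

section PointedDiscs

variable (E : Type*) [NormedAddCommGroup E] [NormedSpace ℂ E]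

/-- Bounded continuous maps on `ℂ` that are holomorphic on the unit disc and vanish at `1`. -/
def pointedDiscs : Set (ℂ →ᵇ E) := {g | DifferentiableOn ℂ g (ball 0 1) ∧ g 1 = 0}

theorem isClosed_pointedDiscs [CompleteSpace E] : IsClosed (pointedDiscs E) := by
  refine IsSeqClosed.isClosed fun u g hu hg => ⟨?_, ?_⟩
  · have h := (BoundedContinuousFunction.tendsto_iff_tendstoUniformly.1 hg)
    exact (h.tendstoUniformlyOn (s := ball (0 : ℂ) 1)).tendstoLocallyUniformlyOn.differentiableOn
      (Eventually.of_forall fun j => (hu j).1) isOpen_ball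
  · have h := (BoundedContinuousFunction.tendsto_iff_tendstoUniformly.1 hg).tendsto_at 1
    simp only [fun j => (hu j).2] at h
    exact (tendsto_nhds_unique h tendsto_const_nhds)

variable {E}

/-- A pointed disc can be moved through any prescribed point near its value at `a`, at a cost
controlled independently of `a`. -/
theorem exists_pointedDisc_apply_eq {g : ℂ →ᵇ E} (hg : g ∈ pointedDiscs E) {a : ℝ}
    (h₀ : 0 < a) (h₁ : a < 1) (w : E) :
    ∃ g' ∈ pointedDiscs E, g' a = w ∧ dist g' g ≤ 4 * ‖w - g a‖ := by
  have hbound : ∀ ζ, ‖discPeak a (discRetraction ζ) • (w - g a)‖ ≤ 4 * ‖w - g a‖ := by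
    intro ζ
    rw [norm_smul]
    gcongr
    exact norm_discPeak_le h₀ h₁ (norm_discRetraction_le ζ)
  have hcont : Continuous fun ζ => discPeak a (discRetraction ζ) • (w - g a) :=
    ((continuousOn_discPeak h₀ h₁).comp_continuous continuous_discRetraction
      norm_discRetraction_le).smul continuous_const
  let k : ℂ →ᵇ E := BoundedContinuousFunction.ofNormedAddCommGroup _ hcont _ hbound
  have hk : ∀ ζ : ℂ, ‖ζ‖ ≤ 1 → k ζ = discPeak a ζ • (w - g a) := fun ζ hζ => by
    change discPeak a (discRetraction ζ) • (w - g a) = _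
    rw [discRetraction_of_norm_le hζ]
  have ha : ‖(a : ℂ)‖ ≤ 1 := by
    rw [Complex.norm_real, Real.norm_of_nonneg h₀.le]
    exact h₁.le
  refine ⟨g + k, ⟨?_, ?_⟩, ?_, ?_⟩
  · have hd := hg.1.add ((differentiableOn_discPeak h₀ h₁).smul_const (w - g a))
    refine hd.congr fun ζ hζ => ?_
    rw [BoundedContinuousFunction.coe_add, Pi.add_apply, hk ζ (mem_ball_zero_iff.1 hζ).le]
    rfl
  · simp [hg.2, hk 1 (by simp), discPeak_one]
  · simp [hk a ha, discPeak_self h₀ h₁]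
  · rw [dist_eq_norm, add_sub_cancel_left]
    exact (BoundedContinuousFunction.norm_le (by positivity)).2 hbound

end PointedDiscs

/-- If a sequence of continuous functions is uniformly Cauchy along every analytic disc in the
ball `ball p r`, then for each `ε` the sequence is `ε`-Cauchy uniformly near `p`. -/
theorem exists_forall_nhds_dist_le_of_discs {E : Type*} [NormedAddCommGroup E] [NormedSpace ℂ E]
    [CompleteSpace E] {G : Type*} [PseudoMetricSpace G] {f : ℕ → E → G} {p : E} {r : ℝ}
    (hr : 0 < r) (hf : ∀ j, ContinuousOn (f j) (ball p r))
    (hc : ∀ φ : ℂ → E, DifferentiableOn ℂ φ (ball (0 : ℂ) 1) →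
      ContinuousOn φ (closedBall (0 : ℂ) 1) → φ '' closedBall (0 : ℂ) 1 ⊆ ball p r →
      UniformCauchySeqOn (fun j ζ => f j (φ ζ)) atTop (closedBall (0 : ℂ) 1))
    {ε : ℝ} (hε : 0 < ε) :
    ∃ N, ∀ᶠ z in 𝓝 p, ∀ i ≥ N, ∀ j ≥ N, dist (f i z) (f j z) ≤ ε := by
  have hmem : ∀ g : ℂ →ᵇ E, ‖g‖ < r → ∀ ζ, p + g ζ ∈ ball p r := fun g hg ζ => by
    simpa using (g.norm_coe_le_norm ζ).trans_lt hg
  let A : ℕ → Set (pointedDiscs E) := fun N =>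
    {g | ∀ i ≥ N, ∀ j ≥ N, ∀ ζ ∈ closedBall (0 : ℂ) 1, ‖g.1‖ < r →
      dist (f i (p + g.1 ζ)) (f j (p + g.1 ζ)) ≤ ε}
  have hA : ∀ N, IsClosed (A N) := by
    intro N
    simp only [A, Set.ofPred_forall]
    refine isClosed_iInter fun i => isClosed_iInter fun _ => isClosed_iInter fun j =>
      isClosed_iInter fun _ => isClosed_iInter fun ζ => isClosed_iInter fun _ => ?_
    have hopen : IsOpen {g : pointedDiscs E | ‖g.1‖ < r} :=
      isOpen_lt (by fun_prop) continuous_const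
    have heval : Continuous fun g : pointedDiscs E => p + g.1 ζ :=
      continuous_const.add ((continuous_eval_const ζ).comp continuous_subtype_val)
    have hcomp : ∀ j, ContinuousOn (fun g : pointedDiscs E => f j (p + g.1 ζ))
        {g | ‖g.1‖ < r} := fun j =>
      (hf j).comp heval.continuousOn fun g hg => hmem g.1 hg ζ
    have hO := (continuous_dist.comp_continuousOn ((hcomp i).prodMk (hcomp j))).isOpen_inter_preimage
      hopen (isOpen_Ioi (a := ε))
    rw [← isOpen_compl_iff]
    convert hO using 1
    ext g
    simp
  have hcover : ⋃ N, A N = Set.univ := by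
    refine Set.eq_univ_of_forall fun g => Set.mem_iUnion.2 ?_
    by_cases hg : ‖g.1‖ < r
    · have h := hc (fun ζ => p + g.1 ζ) (g.2.1.const_add p)
        (by fun_prop) (by rintro _ ⟨ζ, -, rfl⟩; exact hmem g.1 hg ζ)
      obtain ⟨N, hN⟩ := Metric.uniformCauchySeqOn_iff.1 h ε hε
      exact ⟨N, fun i hi j hj ζ hζ _ => (hN i hi j hj ζ hζ).le⟩
    · exact ⟨0, fun i _ j _ ζ _ h => absurd h hg⟩
  have hzero : (0 : ℂ →ᵇ E) ∈ pointedDiscs E := ⟨differentiableOn_const 0, rfl⟩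
  have : CompleteSpace (pointedDiscs E) := (isClosed_pointedDiscs E).completeSpace_coe
  obtain ⟨g, hgA, hgr⟩ := (dense_iUnion_interior_of_closed hA hcover).exists_mem_open
    (isOpen_lt (f := fun g : pointedDiscs E => ‖g.1‖) (by fun_prop) continuous_const)
    ⟨⟨0, hzero⟩, by simpa using hr⟩
  obtain ⟨N, hN⟩ := Set.mem_iUnion.1 hgA
  have hnhds : interior (A N) ∩ {g | ‖g.1‖ < r} ∈ 𝓝 g :=
    (isOpen_interior.inter (isOpen_lt (by fun_prop) continuous_const)).mem_nhds ⟨hN, hgr⟩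
  obtain ⟨s, hs, hball⟩ := Metric.mem_nhds_iff.1 hnhds
  have hlim : Tendsto (fun a : ℝ => ‖g.1 a‖) (𝓝[<] 1) (𝓝 0) := by
    have h : Continuous fun a : ℝ => ‖g.1 a‖ := by fun_prop
    simpa [g.2.2] using (h.tendsto 1).mono_left nhdsWithin_le_nhds
  obtain ⟨a, hga, h₀, h₁⟩ := ((hlim.eventually_lt_const (by positivity : 0 < s / 16)).and
    (Ioo_mem_nhdsLT one_pos)).exists
  refine ⟨N, ?_⟩
  filter_upwards [ball_mem_nhds p (by positivity : 0 < s / 16)] with z hz i hi j hj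
  obtain ⟨g', hg', hval, hdist⟩ := exists_pointedDisc_apply_eq g.2 h₀ h₁ (z - p)
  have hlt : dist g' g.1 < s := by
    rw [mem_ball, dist_eq_norm] at hz
    linarith [norm_sub_le (z - p) (g.1 a)]
  obtain ⟨hint, hnorm⟩ := hball (show (⟨g', hg'⟩ : pointedDiscs E) ∈ ball g s from hlt)
  have ha : (a : ℂ) ∈ closedBall (0 : ℂ) 1 := by
    rw [mem_closedBall_zero_iff, Complex.norm_real, Real.norm_of_nonneg h₀.le]
    exact h₁.le
  have := interior_subset hint i hi j hj a ha hnorm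
  simpa [hval] using this

/-- If for every analytic disc `φ : D → Ω` (holomorphic on the open unit disc,
continuous up to the closed disc, with image in `Ω`) the functions `f_j ∘ φ` converge
uniformly on the closed disc to `f ∘ φ`, then `f` is holomorphic on `Ω ⊆ ℂⁿ`, `n ≥ 2`. -/
theorem holomorphic_of_uniform_convergence_on_analytic_discs
    (n : ℕ) (hn : 2 ≤ n)
    (Ω : Set (Fin n → ℂ)) (hΩopen : IsOpen Ω) (hΩconn : IsConnected Ω)
    (f : ℕ → (Fin n → ℂ) → ℂ) (F : (Fin n → ℂ) → ℂ)
    (hf : ∀ j, DifferentiableOn ℂ (f j) Ω)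
    (hconv : ∀ φ : ℂ → (Fin n → ℂ),
      DifferentiableOn ℂ φ (ball (0 : ℂ) 1) →
      ContinuousOn φ (closedBall (0 : ℂ) 1) →
      φ '' closedBall (0 : ℂ) 1 ⊆ Ω →
      TendstoUniformlyOn (fun j ζ => f j (φ ζ)) (fun ζ => F (φ ζ)) atTop
        (closedBall (0 : ℂ) 1)) :
    DifferentiableOn ℂ F Ω := by
  have hlim : ∀ z ∈ Ω, Tendsto (fun j => f j z) atTop (𝓝 (F z)) := by
    intro z hz
    refine (hconv (fun _ => z) (differentiableOn_const z) continuousOn_const ?_).tendsto_at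
      (mem_closedBall_self zero_le_one)
    rintro _ ⟨_, -, rfl⟩
    exact hz
  refine TendstoLocallyUniformlyOn.differentiableOn_complex hΩopen hf ?_
  rw [Metric.tendstoLocallyUniformlyOn_iff]
  intro ε hε x hx
  obtain ⟨r, hr, hrΩ⟩ := Metric.isOpen_iff.1 hΩopen x hx
  obtain ⟨N, hN⟩ := exists_forall_nhds_dist_le_of_discs hr
    (fun j => (hf j).continuousOn.mono hrΩ)
    (fun φ hd hcont hsub => (hconv φ hd hcont (hsub.trans hrΩ)).uniformCauchySeqOn)
    (half_pos hε)
  refine ⟨_, mem_nhdsWithin_of_mem_nhds (inter_mem hN (hΩopen.mem_nhds hx)), ?_⟩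
  filter_upwards [eventually_ge_atTop N] with j hj z hz
  have hle : dist (F z) (f j z) ≤ ε / 2 :=
    le_of_tendsto ((hlim z hz.2).dist tendsto_const_nhds)
      ((eventually_ge_atTop N).mono fun i hi => hz.1 i hi j hj)
  linarith
end

section
/- Let U = {z ∈ ℂ : |Re z| < 1, |Im z| < 1} be the open unit square, and let A = {z ∈ U : Re z = 0 or Im z = 0} be the union of the two coordinate axes intersected with U. There exists a sequence {f_j} of holomorphic functions on U converging pointwise on U to the function f defined by f(z) = 1 for z ∈ A and f(z) = 0 for z ∈ U \ A. -/
open Filter Topology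

open Polynomial in
/-- On a compact plane set `K` with connected complement, a uniform limit of polynomials without
zeros on `K` is invertible in the algebra of uniform limits of polynomials on `K`. -/
theorem isUnit_topologicalClosure_polynomialFunctions {K : Set ℂ} [CompactSpace K]
    (hK : IsPreconnected Kᶜ) (f : (polynomialFunctions K).topologicalClosure)
    (hf : ∀ z, (f : C(K, ℂ)) z ≠ 0) : IsUnit f := by
  have hclosed : IsClosed ((polynomialFunctions K).topologicalClosure : Set C(K, ℂ)) :=
    Subalgebra.isClosed_topologicalClosure _
  have : CompleteSpace (polynomialFunctions K).topologicalClosure :=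
    hclosed.isComplete.completeSpace_coe
  let ι : ℂ[X] →ₐ[ℂ] (polynomialFunctions K).topologicalClosure :=
    (toContinuousMapOnAlgHom K).codRestrict _ fun p ↦
      Subalgebra.le_topologicalClosure _ (by simp [polynomialFunctions])
  have hι : DenseRange ι := by
    refine Metric.denseRange_iff.2 fun g r hr ↦ ?_
    obtain ⟨_, ⟨p, -, rfl⟩, hp⟩ := Metric.mem_closure_iff.1 g.2 r hr
    exact ⟨p, hp⟩
  have hrange : spectrum ℂ (ι X : C(K, ℂ)) = K := by
    rw [ContinuousMap.spectrum_eq_range]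
    ext z
    simp [ι, Polynomial.toContinuousMapOn]
  have hspec : spectrum ℂ (ι X) = K := by
    rw [Subalgebra.spectrum_eq_of_isPreconnected_compl, hrange]
    rwa [hrange]
  by_contra hunit
  obtain ⟨φ, hφ⟩ := WeakDual.CharacterSpace.exists_apply_eq_zero hunit
  have hk : φ (ι X) ∈ K := by
    have := AlgHom.apply_mem_spectrum φ (ι X)
    rwa [hspec] at this
  have heval : (φ : (polynomialFunctions K).topologicalClosure → ℂ) =
      fun g : (polynomialFunctions K).topologicalClosure ↦ (g : C(K, ℂ)) ⟨φ (ι X), hk⟩ := by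
    refine hι.equalizer (map_continuous φ) ?_ ?_
    · exact (continuous_eval_const _).comp continuous_subtype_val
    · ext p
      have : φ (ι p) = aeval (φ (ι X)) p := by
        rw [aeval_algHom_apply, aeval_algHom_apply, aeval_X_left_apply]
      simp only [Function.comp, this]
      simp [ι, Polynomial.toContinuousMapOn, aeval_def, eval₂_eq_eval_map]
  exact hf _ ((congrFun heval f).symm.trans hφ)

/-- On a compact plane set `K` with connected complement, polynomials approximate the logistic
functions without poles on `K` uniformly. -/
theorem exists_polynomial_norm_sub_inv_one_add_exp_lt {K : Set ℂ} (hKc : IsCompact K)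
    (hK : IsPreconnected Kᶜ) (c d : ℂ) (h : ∀ z ∈ K, 1 + Complex.exp (c * z + d) ≠ 0)
    {ε : ℝ} (hε : 0 < ε) :
    ∃ p : Polynomial ℂ, ∀ z ∈ K, ‖p.eval z - (1 + Complex.exp (c * z + d))⁻¹‖ < ε := by
  have := isCompact_iff_compactSpace.1 hKc
  have hclosed : IsClosed ((polynomialFunctions K).topologicalClosure : Set C(K, ℂ)) :=
    Subalgebra.isClosed_topologicalClosure _
  let l : C(K, ℂ) := (Polynomial.C c * Polynomial.X + Polynomial.C d).toContinuousMapOn K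
  have hl : l ∈ (polynomialFunctions K).topologicalClosure :=
    Subalgebra.le_topologicalClosure _ (by simp [polynomialFunctions, l])
  have hexp (z : K) : NormedSpace.exp l z = Complex.exp (c * z + d) := by
    have := NormedSpace.map_exp (ContinuousMap.evalAlgHom ℂ ℂ z)
      (continuous_eval_const z) l
    simpa [l, Polynomial.toContinuousMapOn, Complex.exp_eq_exp_ℂ] using this
  let f : (polynomialFunctions K).topologicalClosure :=
    1 + ⟨NormedSpace.exp l, NormedSpace.exp_mem hclosed hl⟩
  have hf (z : K) : (f : C(K, ℂ)) z = 1 + Complex.exp (c * z + d) := by simp [f, hexp]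
  obtain ⟨g, hg⟩ := (isUnit_topologicalClosure_polynomialFunctions hK f fun z ↦ by
    rw [hf]; exact h z z.2).exists_right_inv
  obtain ⟨_, ⟨p, -, rfl⟩, hp⟩ := Metric.mem_closure_iff.1 g.2 ε hε
  refine ⟨p, fun z hz ↦ ?_⟩
  have hgz : (g : C(K, ℂ)) ⟨z, hz⟩ = (1 + Complex.exp (c * z + d))⁻¹ := by
    refine eq_inv_of_mul_eq_one_right ?_
    have := congrArg (fun u : (polynomialFunctions K).topologicalClosure ↦
      (u : C(K, ℂ)) ⟨z, hz⟩) hg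
    simpa [hf] using this
  rw [← hgz, ← dist_eq_norm, dist_comm]
  exact (ContinuousMap.dist_apply_le_dist _).trans_lt hp

/-- The complement of the union of two rectangles, one above the other, is connected. -/
theorem isPreconnected_compl_two_rectangles {δ : ℝ} (hδ : 0 < δ) :
    IsPreconnected {z : ℂ | |z.re| ≤ 1 ∧ |z.im| ≤ 1 ∧ (z.im ≤ 0 ∨ δ ≤ z.im)}ᶜ := by
  have hset : {z : ℂ | |z.re| ≤ 1 ∧ |z.im| ≤ 1 ∧ (z.im ≤ 0 ∨ δ ≤ z.im)}ᶜ =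
      ((({z : ℂ | 1 < z.im} ∪ {z : ℂ | 1 < z.re}) ∪ {z : ℂ | z.im < -1}) ∪ {z : ℂ | z.re < -1}) ∪
        ({z : ℂ | 0 < z.im} ∩ {z : ℂ | z.im < δ}) := by
    ext z
    simp only [Set.mem_compl_iff, Set.mem_ofPred_eq, Set.mem_union, Set.mem_inter_iff, abs_le]
    grind
  rw [hset]
  refine .union' ⟨⟨2, δ / 2⟩, ?_⟩ (.union' ⟨⟨-2, -2⟩, ?_⟩ (.union' ⟨⟨2, -2⟩, ?_⟩
    (.union' ⟨⟨2, 2⟩, ?_⟩ (convex_halfSpace_im_gt 1).isPreconnected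
      (convex_halfSpace_re_gt 1).isPreconnected) (convex_halfSpace_im_lt _).isPreconnected)
    (convex_halfSpace_re_lt _).isPreconnected)
    ((convex_halfSpace_im_gt 0).inter (convex_halfSpace_im_lt δ)).isPreconnected
  · simp; grind
  all_goals norm_num

theorem isCompact_two_rectangles (δ : ℝ) :
    IsCompact {z : ℂ | |z.re| ≤ 1 ∧ |z.im| ≤ 1 ∧ (z.im ≤ 0 ∨ δ ≤ z.im)} := by
  refine Metric.isCompact_of_isClosed_isBounded ?_ ?_
  · have hre : Continuous fun z : ℂ ↦ |z.re| := Complex.continuous_re.abs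
    have him : Continuous fun z : ℂ ↦ |z.im| := Complex.continuous_im.abs
    exact (isClosed_le hre continuous_const).inter ((isClosed_le him continuous_const).inter
      ((isClosed_le Complex.continuous_im continuous_const).union
        (isClosed_le continuous_const Complex.continuous_im)))
  · refine isBounded_iff_forall_norm_le.2 ⟨2, fun z hz ↦ ?_⟩
    linarith [Complex.norm_le_abs_re_add_abs_im z, hz.1, hz.2.1]

/-- Polynomials can converge pointwise on the square to the indicator of the open upper half. -/
theorem exists_polynomial_tendsto_indicator_im_pos :
    ∃ p : ℕ → Polynomial ℂ, ∀ z : ℂ, |z.re| ≤ 1 → |z.im| ≤ 1 →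
      Tendsto (fun n ↦ (p n).eval z) atTop (𝓝 (if 0 < z.im then 1 else 0)) := by
  -- on the two rectangles, `exp (c n * z + d n)` has norm at most `exp (-n)` or at least `exp n`
  let c (n : ℕ) : ℂ := 2 * n ^ 2 * Complex.I
  let d (n : ℕ) : ℂ := n
  have hnorm (n : ℕ) (z : ℂ) : ‖Complex.exp (c n * z + d n)‖ = Real.exp (n - 2 * n ^ 2 * z.im) := by
    rw [Complex.norm_exp]
    congr 1
    have : c n = (2 * (n : ℝ) ^ 2 : ℝ) * Complex.I := by simp [c]
    rw [this, mul_assoc, Complex.add_re, Complex.re_ofReal_mul]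
    simp [d]
    ring
  have hre (n : ℕ) (hn : 0 < n) (z : ℂ) (hz : z.im ≤ 0 ∨ 1 / (n : ℝ) ≤ z.im) :
      1 + Complex.exp (c n * z + d n) ≠ 0 := by
    intro h
    have h1 : ‖Complex.exp (c n * z + d n)‖ = 1 := by
      rw [eq_neg_of_add_eq_zero_right h]; simp
    rw [hnorm, Real.exp_eq_one_iff] at h1
    have hn' : (0 : ℝ) < n := by exact_mod_cast hn
    rcases hz with hz | hz
    · nlinarith [sq_nonneg (n : ℝ)]
    · rw [div_le_iff₀ hn'] at hz
      nlinarith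
  have key (n : ℕ) (hn : 0 < n) : ∃ p : Polynomial ℂ,
      ∀ z ∈ {z : ℂ | |z.re| ≤ 1 ∧ |z.im| ≤ 1 ∧ (z.im ≤ 0 ∨ 1 / (n : ℝ) ≤ z.im)},
        ‖p.eval z - (1 + Complex.exp (c n * z + d n))⁻¹‖ < 1 / n :=
    exists_polynomial_norm_sub_inv_one_add_exp_lt (isCompact_two_rectangles _)
      (isPreconnected_compl_two_rectangles (by positivity)) _ _
      (fun z hz ↦ hre n hn z hz.2.2) (by positivity)
  choose! p hp using key
  refine ⟨p, fun z hzr hzi ↦ ?_⟩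
  have hdiff : Tendsto (fun n ↦ (p n).eval z - (1 + Complex.exp (c n * z + d n))⁻¹) atTop
      (𝓝 0) := by
    refine squeeze_zero_norm' ?_ tendsto_one_div_atTop_nhds_zero_nat
    by_cases hz : 0 < z.im
    · filter_upwards [eventually_gt_atTop 0,
        tendsto_one_div_atTop_nhds_zero_nat.eventually_le_const hz] with n hn hn'
      exact (hp n hn z ⟨hzr, hzi, .inr hn'⟩).le
    · filter_upwards [eventually_gt_atTop 0] with n hn
      exact (hp n hn z ⟨hzr, hzi, .inl (not_lt.1 hz)⟩).le
  suffices h : Tendsto (fun n ↦ (1 + Complex.exp (c n * z + d n))⁻¹) atTop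
      (𝓝 (if 0 < z.im then 1 else 0)) by simpa using hdiff.add h
  split_ifs with hz
  · have h0 : Tendsto (fun n ↦ Complex.exp (c n * z + d n)) atTop (𝓝 0) := by
      refine squeeze_zero_norm' ?_ (Real.tendsto_exp_neg_atTop_nhds_zero.comp
        tendsto_natCast_atTop_atTop)
      filter_upwards [eventually_gt_atTop 0,
        tendsto_one_div_atTop_nhds_zero_nat.eventually_le_const hz] with n hn hn'
      have hn0 : (0 : ℝ) < n := by exact_mod_cast hn
      rw [div_le_iff₀ hn0] at hn'
      rw [hnorm]
      refine Real.exp_le_exp.2 ?_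
      nlinarith
    simpa using (h0.const_add 1).inv₀ (by simp)
  · refine tendsto_inv₀_cobounded.comp ((tendsto_const_add_cobounded (1 : ℂ)).comp ?_)
    refine tendsto_norm_atTop_iff_cobounded.1 (tendsto_atTop_mono ?_
      (Real.tendsto_exp_atTop.comp tendsto_natCast_atTop_atTop))
    intro n
    rw [hnorm]
    refine Real.exp_le_exp.2 ?_
    nlinarith [sq_nonneg (n : ℝ)]

/-- On the open unit square `U`, there is a sequence of holomorphic functions
converging pointwise to the function which is `1` on the intersection of the two
coordinate axes with `U` and `0` elsewhere on `U`. -/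
theorem exists_holomorphic_sequence_tendsto_indicator_of_axes :
    ∃ f : ℕ → ℂ → ℂ,
      (∀ j, DifferentiableOn ℂ (f j) {z : ℂ | |z.re| < 1 ∧ |z.im| < 1}) ∧
      ∀ z ∈ {z : ℂ | |z.re| < 1 ∧ |z.im| < 1},
        Tendsto (fun j => f j z) atTop
          (𝓝 (if z.re = 0 ∨ z.im = 0 then (1 : ℂ) else 0)) := by
  obtain ⟨p, hp⟩ := exists_polynomial_tendsto_indicator_im_pos
  let g (n : ℕ) (z : ℂ) : ℂ := (1 - (p n).eval z) * (1 - (p n).eval (-z))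
  have hg (z : ℂ) (hzr : |z.re| ≤ 1) (hzi : |z.im| ≤ 1) :
      Tendsto (fun n ↦ g n z) atTop (𝓝 (if z.im = 0 then 1 else 0)) := by
    have h := ((hp z hzr hzi).const_sub 1).mul
      ((hp (-z) (by simpa using hzr) (by simpa using hzi)).const_sub 1)
    convert h using 2
    rcases lt_trichotomy z.im 0 with hz | hz | hz
    · simp [hz, hz.ne]
    · simp [hz]
    · simp [hz, hz.ne']
  refine ⟨fun n z ↦ 1 - (1 - g n z) * (1 - g n (Complex.I * z)), fun n ↦ ?_, fun z hz ↦ ?_⟩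
  · have hd : Differentiable ℂ (g n) :=
      ((p n).differentiable.const_sub 1).mul
        (((p n).differentiable.comp differentiable_neg).const_sub 1)
    exact (((hd.const_sub 1).mul
      ((hd.comp (differentiable_id.const_mul Complex.I)).const_sub 1)).const_sub 1).differentiableOn
  · have h := (((hg z hz.1.le hz.2.le).const_sub 1).mul
      ((hg (Complex.I * z) (by simpa using hz.2.le) (by simpa using hz.1.le)).const_sub
        1)).const_sub 1
    convert h using 2
    by_cases hr : z.re = 0 <;> by_cases hi : z.im = 0 <;> simp [hr, hi]
end

section
/- Let Ω be a domain (nonempty connected open set) in ℂ, let {f_j} be a sequence of holomorphic functions on Ω converging pointwise on Ω, and let U be a nonempty open subset of Ω whose closure is compact and contained in Ω. For each positive integer k set S_k = {z ∈ closure(U) : |f_j(z)| ≤ k for all j}. Then closure(U) = ⋃_k S_k, and there exists some k such that S_k is somewhere dense in closure(U), i.e., the closure of S_k contains a nonempty open Euclidean disc intersected with closure(U); in particular, there is a nonempty open disc B ⊆ U on which the family {f_j} is uniformly bounded. -/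
open Filter Topology Metric

/-- In a Baire space, if countably many closed sets cover a nonempty open set `U`, then the
interior of one of them meets `U`. -/
theorem IsOpen.exists_inter_interior_nonempty_of_subset_iUnion_isClosed {X ι : Type*}
    [TopologicalSpace X] [BaireSpace X] [Countable ι] {U : Set X} {F : ι → Set X}
    (hU : IsOpen U) (hne : U.Nonempty) (hF : ∀ i, IsClosed (F i)) (hcover : U ⊆ ⋃ i, F i) :
    ∃ i, (U ∩ interior (F i)).Nonempty := by
  have hdense : Dense (⋃ i : Option ι, interior (i.elim Uᶜ F)) := by
    refine dense_iUnion_interior_of_closed ?_ ?_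
    · rintro (_ | i)
      exacts [hU.isClosed_compl, hF i]
    · refine Set.eq_univ_of_forall fun x => ?_
      by_cases hx : x ∈ U
      · obtain ⟨i, hi⟩ := Set.mem_iUnion.1 (hcover hx)
        exact Set.mem_iUnion.2 ⟨some i, hi⟩
      · exact Set.mem_iUnion.2 ⟨none, hx⟩
  obtain ⟨x, hxU, hx⟩ := hdense.inter_open_nonempty U hU hne
  obtain ⟨_ | i, hi⟩ := Set.mem_iUnion.1 hx
  · exact absurd hxU (interior_subset hi)
  · exact ⟨i, x, hxU, hi⟩

/-- The points of a closed set at which all members of a family of functions continuous on that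
set are bounded in norm by `C` form a closed set. -/
theorem IsClosed.isClosed_setOf_forall_norm_le {X E ι : Type*} [TopologicalSpace X]
    [SeminormedAddCommGroup E] {K : Set X} {f : ι → X → E} (hK : IsClosed K)
    (hf : ∀ i, ContinuousOn (f i) K) (C : ℝ) :
    IsClosed {x ∈ K | ∀ i, ‖f i x‖ ≤ C} := by
  have heq : {x ∈ K | ∀ i, ‖f i x‖ ≤ C} = K ∩ ⋂ i, K ∩ (fun x => ‖f i x‖) ⁻¹' Set.Iic C := by
    ext x
    simp +contextual
  rw [heq]
  exact hK.inter <| isClosed_iInter fun i =>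
    (hf i).norm.preimage_isClosed_of_isClosed hK isClosed_Iic

/-- **Baire-category step in Osgood's theorem.** If a sequence of holomorphic functions
converges pointwise on a domain `Ω ⊆ ℂ` and `U` is a nonempty open set with compact
closure contained in `Ω`, then with `S_k = {z ∈ closure U : |f_j(z)| ≤ k for all j}`
one has `closure U = ⋃_{k ≥ 1} S_k`; some `S_k` is somewhere dense in `closure U`
(its closure contains a nonempty set of the form (open disc) ∩ closure U); and in
particular the family `{f_j}` is uniformly bounded on some nonempty open disc `B ⊆ U`. -/
theorem baire_step_somewhere_dense_bounded
    (Ω : Set ℂ) (hΩopen : IsOpen Ω) (hΩconn : IsConnected Ω)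
    (f : ℕ → ℂ → ℂ)
    (hf : ∀ j, DifferentiableOn ℂ (f j) Ω)
    (hconv : ∀ z ∈ Ω, ∃ w : ℂ, Tendsto (fun j => f j z) atTop (𝓝 w))
    (U : Set ℂ) (hUopen : IsOpen U) (hUne : U.Nonempty)
    (hUcl : IsCompact (closure U)) (hUΩ : closure U ⊆ Ω)
    (S : ℕ → Set ℂ)
    (hS : ∀ k, S k = {z ∈ closure U | ∀ j, ‖f j z‖ ≤ (k : ℝ)}) :
    closure U = (⋃ k : ℕ, S (k + 1)) ∧
    (∃ (k : ℕ) (P : ℂ) (r : ℝ), 0 < k ∧ 0 < r ∧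
      (ball P r ∩ closure U).Nonempty ∧ ball P r ∩ closure U ⊆ closure (S k)) ∧
    ∃ (Q : ℂ) (s : ℝ), 0 < s ∧ ball Q s ⊆ U ∧
      ∃ M : ℝ, ∀ j, ∀ z ∈ ball Q s, ‖f j z‖ ≤ M := by
  have hunion : closure U = ⋃ k : ℕ, S (k + 1) := by
    ext z
    simp only [hS, Set.mem_iUnion, Set.mem_ofPred_eq]
    refine ⟨fun hz => ?_, fun ⟨_, hz, _⟩ => hz⟩
    obtain ⟨w, hw⟩ := hconv z (hUΩ hz)
    obtain ⟨C, hC⟩ := hw.norm.bddAbove_range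
    obtain ⟨k, hk⟩ := exists_nat_ge C
    refine ⟨k, hz, fun j => (hC (Set.mem_range_self j)).trans (hk.trans ?_)⟩
    exact_mod_cast k.le_succ
  have hclosed (k : ℕ) : IsClosed (S (k + 1)) := by
    rw [hS]
    exact isClosed_closure.isClosed_setOf_forall_norm_le
      (fun j => (hf j).continuousOn.mono hUΩ) _
  obtain ⟨k, P, hPU, hPS⟩ :=
    hUopen.exists_inter_interior_nonempty_of_subset_iUnion_isClosed hUne hclosed
      (subset_closure.trans hunion.subset)
  obtain ⟨r, hr, hball⟩ := Metric.isOpen_iff.1 (hUopen.inter isOpen_interior) P ⟨hPU, hPS⟩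
  have hballS : ball P r ⊆ S (k + 1) := fun z hz => interior_subset (hball hz).2
  refine ⟨hunion, ⟨k + 1, P, r, k.succ_pos, hr, ⟨P, mem_ball_self hr, subset_closure hPU⟩,
    fun z hz => subset_closure (hballS hz.1)⟩, P, r, hr, fun z hz => (hball hz).1,
    ((k + 1 : ℕ) : ℝ), fun j z hz => ?_⟩
  have hz' := hballS hz
  rw [hS] at hz'
  exact hz'.2 j
end

section
/- Let Ω be a domain (nonempty connected open set) in ℂ, and let {f_j} be a sequence of holomorphic functions on Ω that is uniformly bounded on each compact subset of Ω and converges pointwise on Ω to a limit function f. Then f_j → f uniformly on every compact subset of Ω, and f is holomorphic on Ω. -/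
open Filter Topology

/-- A family of holomorphic functions on a ball which is uniformly bounded there is
equicontinuous at the center. -/
theorem equicontinuousAt_of_differentiableOn_ball_of_norm_le {ι : Type*} {f : ι → ℂ → ℂ}
    {c : ℂ} {r M : ℝ} (hr : 0 < r) (hf : ∀ j, DifferentiableOn ℂ (f j) (Metric.ball c r))
    (hM : ∀ j, ∀ z ∈ Metric.ball c r, ‖f j z‖ ≤ M) : EquicontinuousAt f c := by
  refine Metric.equicontinuousAt_of_continuity_modulus
    (fun z => (M + M) / r * dist z c) ?_ f ?_
  · have h : Continuous fun z : ℂ => (M + M) / r * dist z c := by fun_prop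
    simpa using h.tendsto c
  · filter_upwards [Metric.ball_mem_nhds c hr] with z hz j
    rw [dist_comm]
    refine Complex.dist_le_div_mul_dist_of_mapsTo_ball (hf j) (fun w hw => ?_) hz
    rw [Metric.mem_closedBall, dist_eq_norm]
    exact (norm_sub_le _ _).trans
      (add_le_add (hM j w hw) (hM j c (Metric.mem_ball_self hr)))

/-- **Montel's theorem**, equicontinuity form: a family of holomorphic functions on an open set
which is uniformly bounded on compact subsets is equicontinuous at every point. -/
theorem equicontinuousAt_of_differentiableOn_of_bounded_on_compacts {ι : Type*}
    {f : ι → ℂ → ℂ} {Ω : Set ℂ} (hΩ : IsOpen Ω) (hf : ∀ j, DifferentiableOn ℂ (f j) Ω)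
    (hbd : ∀ K ⊆ Ω, IsCompact K → ∃ M > 0, ∀ j, ∀ z ∈ K, ‖f j z‖ ≤ M)
    {c : ℂ} (hc : c ∈ Ω) : EquicontinuousAt f c := by
  obtain ⟨r, hr, hrΩ⟩ := Metric.nhds_basis_closedBall.mem_iff.mp (hΩ.mem_nhds hc)
  obtain ⟨M, -, hM⟩ := hbd _ hrΩ (isCompact_closedBall c r)
  exact equicontinuousAt_of_differentiableOn_ball_of_norm_le hr
    (fun j => (hf j).mono (Metric.ball_subset_closedBall.trans hrΩ))
    fun j z hz => hM j z (Metric.ball_subset_closedBall hz)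

/-- An equicontinuous family on a compact set which converges pointwise converges uniformly. -/
theorem EquicontinuousOn.tendstoUniformlyOn_of_tendsto {ι X α : Type*} [TopologicalSpace X]
    [UniformSpace α] {f : ι → X → α} {F : X → α} {l : Filter ι} {K : Set X}
    (hK : IsCompact K) (hf : EquicontinuousOn f K)
    (hconv : ∀ x ∈ K, Tendsto (fun j => f j x) l (𝓝 (F x))) : TendstoUniformlyOn f F l K := by
  have h := (EquicontinuousOn.tendsto_uniformOnFun_iff_pi' (𝔖 := {K})
    (by simpa using hK) (by simpa using hf) l F).mpr
    (tendsto_pi_nhds.mpr fun x => hconv x (by simpa using x.2))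
  exact UniformOnFun.tendsto_iff_tendstoUniformlyOn.mp h K rfl

/-- A sequence of holomorphic functions on a planar domain that is uniformly bounded
on each compact subset and converges pointwise, converges uniformly on every compact
subset, and the limit is holomorphic on the whole domain. -/
theorem pointwise_limit_locally_bounded_holomorphic
    (Ω : Set ℂ) (hΩopen : IsOpen Ω) (hΩconn : IsConnected Ω)
    (f : ℕ → ℂ → ℂ) (F : ℂ → ℂ)
    (hf : ∀ j, DifferentiableOn ℂ (f j) Ω)
    (hbd : ∀ K ⊆ Ω, IsCompact K → ∃ M > 0, ∀ j, ∀ z ∈ K, ‖f j z‖ ≤ M)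
    (hconv : ∀ z ∈ Ω, Tendsto (fun j => f j z) atTop (𝓝 (F z))) :
    (∀ K ⊆ Ω, IsCompact K → TendstoUniformlyOn f F atTop K) ∧
      DifferentiableOn ℂ F Ω := by
  have hunif : ∀ K ⊆ Ω, IsCompact K → TendstoUniformlyOn f F atTop K := fun K hKΩ hK =>
    EquicontinuousOn.tendstoUniformlyOn_of_tendsto hK
      (fun z hz => (equicontinuousAt_of_differentiableOn_of_bounded_on_compacts hΩopen hf hbd
        (hKΩ hz)).equicontinuousWithinAt K)
      fun z hz => hconv z (hKΩ hz)
  exact ⟨hunif, ((tendstoLocallyUniformlyOn_iff_forall_isCompact hΩopen).mpr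
    hunif).differentiableOn (Eventually.of_forall hf) hΩopen⟩
end
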